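/- Let p ∈ (0,1) and let (G_t)_{t≥1} be the preferential attachment process with edge-steps with parameter p, and set α = (1−p)/(2−p). Let 𝒯₂¹(G_t) be the number of triples of vertex indices i < j < k with i·j·k ≥ t^{3α} that form a triangle in G_t in which two of the three pairs are joined by edges created at edge-steps and the remaining pair is joined by an edge created at a vertex-step. Then there exists a constant C > 0, depending only on p, such that for all t ≥ 2: E[𝒯₂¹(G_t)] ≤ C · t^{3α} · (log t)⁷. -/

import Mathlib

open MeasureTheory Filter

attribute [local instance] Classical.propDecidable

/-- Degree of vertex `i` at time `t` computed from the endpoint process `ep`: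
the edge added at step `s` contributes `1` for each of its endpoints equal to `i`
(so a loop at `i` contributes `2`). -/
noncomputable def degOf {Ω : Type} (ep : ℕ → Ω → ℕ × ℕ) (t i : ℕ) (ω : Ω) : ℕ :=
  ∑ s ∈ Finset.Icc 1 t,
    ((if (ep s ω).1 = i then 1 else 0) + (if (ep s ω).2 = i then 1 else 0))

/-- The preferential attachment random graph process with edge-steps and parameter `p`.
`G_1` is a single vertex (labeled `1`) with a loop.  At each step `t + 1` (for `t ≥ 1`),
with probability `p` a vertex-step occurs: a new vertex `nv t + 1` is added together with an
edge to an old vertex `u`, chosen with probability `d_t(u) / (2t)`; with probability `1 - p`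
an edge-step occurs: an edge `{u, w}` is added, where `u` and `w` are chosen independently,
each with probability proportional to its degree.  The field `ep t` records the (ordered pair
of) endpoints of the unique edge added at step `t`, `nv t` is the number of vertices of `G_t`,
and `Z t` tells whether step `t` was a vertex-step.  The one-step conditional laws are
prescribed via conditional expectations with respect to a filtration `ℱ` to which the process
is adapted. -/
structure PAProcess (p : ℝ) where
  Ω : Type
  m0 : MeasurableSpace Ω
  μ : Measure Ω
  isProb : IsProbabilityMeasure μ
  ℱ : Filtration ℕ m0
  Z : ℕ → Ω → Bool
  nv : ℕ → Ω → ℕ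
  ep : ℕ → Ω → ℕ × ℕ
  nv_one : ∀ ω, nv 1 ω = 1
  ep_one : ∀ ω, ep 1 ω = (1, 1)
  nv_succ : ∀ t, 1 ≤ t → ∀ ω, nv (t + 1) ω = nv t ω + (if Z (t + 1) ω then 1 else 0)
  ep_vertexStep : ∀ t, 1 ≤ t → ∀ ω, Z (t + 1) ω = true →
    (ep (t + 1) ω).2 = nv t ω + 1 ∧ 1 ≤ (ep (t + 1) ω).1 ∧ (ep (t + 1) ω).1 ≤ nv t ω
  ep_edgeStep : ∀ t, 1 ≤ t → ∀ ω, Z (t + 1) ω = false →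
    1 ≤ (ep (t + 1) ω).1 ∧ (ep (t + 1) ω).1 ≤ nv t ω ∧
    1 ≤ (ep (t + 1) ω).2 ∧ (ep (t + 1) ω).2 ≤ nv t ω
  Z_meas : ∀ t, Measurable[ℱ t] (Z t)
  nv_meas : ∀ t, Measurable[ℱ t] (nv t)
  ep_meas : ∀ t, Measurable[ℱ t] (ep t)
  condLaw_Z : ∀ t, 1 ≤ t →
    μ[Set.indicator {ω | Z (t + 1) ω = true} (fun _ => (1 : ℝ)) | ℱ t] =ᵐ[μ] fun _ => p
  condLaw_vertex : ∀ t, 1 ≤ t → ∀ u,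
    μ[Set.indicator {ω | Z (t + 1) ω = true ∧ ep (t + 1) ω = (u, nv t ω + 1)}
        (fun _ => (1 : ℝ)) | ℱ t]
      =ᵐ[μ] fun ω => p * (degOf ep t u ω : ℝ) / (2 * t)
  condLaw_edge : ∀ t, 1 ≤ t → ∀ u w,
    μ[Set.indicator {ω | Z (t + 1) ω = false ∧ ep (t + 1) ω = (u, w)}
        (fun _ => (1 : ℝ)) | ℱ t]
      =ᵐ[μ] fun ω => (1 - p) * (degOf ep t u ω : ℝ) * (degOf ep t w ω : ℝ) / (2 * t) ^ 2

namespace PAProcess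

variable {p : ℝ} (P : PAProcess p)

/-- degree `d_t(i)` of vertex `i` in `G_t` (`0` if `i` is not yet present). -/
noncomputable def deg (t i : ℕ) (ω : P.Ω) : ℕ := degOf P.ep t i ω

/-- `i` and `j` are joined by at least one edge in `G_t`. -/
def Joined (t i j : ℕ) (ω : P.Ω) : Prop :=
  ∃ s ∈ Finset.Icc 1 t, P.ep s ω = (i, j) ∨ P.ep s ω = (j, i)

/-- number of triangles of `G_t`: sets of three distinct vertices pairwise joined by at
least one edge (counted without edge multiplicities). -/
noncomputable def triangles (t : ℕ) (ω : P.Ω) : ℕ :=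
  ((Finset.Icc 1 t ×ˢ Finset.Icc 1 t ×ˢ Finset.Icc 1 t).filter
    (fun q => q.1 < q.2.1 ∧ q.2.1 < q.2.2 ∧ P.Joined t q.1 q.2.1 ω ∧
      P.Joined t q.1 q.2.2 ω ∧ P.Joined t q.2.1 q.2.2 ω)).card

/-- number of cherries (paths of length 2) of `G_t`: unordered pairs of distinct edges of
`G_t` sharing a common endpoint.  The edges of `G_t` are indexed by their creation times
`1 ≤ s ≤ t`. -/
noncomputable def cherries (t : ℕ) (ω : P.Ω) : ℕ :=
  ((Finset.Icc 1 t ×ˢ Finset.Icc 1 t).filter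
    (fun q => q.1 < q.2 ∧
      ((P.ep q.1 ω).1 = (P.ep q.2 ω).1 ∨ (P.ep q.1 ω).1 = (P.ep q.2 ω).2 ∨
       (P.ep q.1 ω).2 = (P.ep q.2 ω).1 ∨ (P.ep q.1 ω).2 = (P.ep q.2 ω).2))).card

/-- global clustering coefficient of `G_t`. -/
noncomputable def clustering (t : ℕ) (ω : P.Ω) : ℝ :=
  3 * (P.triangles t ω : ℝ) / (P.cherries t ω : ℝ)

/-- clique number of `G_t`: the largest `k` such that `G_t` contains `k` distinct vertices
pairwise joined by at least one edge. -/
noncomputable def cliqueNum (t : ℕ) (ω : P.Ω) : ℕ :=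
  sSup {k | ∃ S : Finset ℕ, S ⊆ Finset.Icc 1 (P.nv t ω) ∧ S.card = k ∧
    ∀ i ∈ S, ∀ j ∈ S, i ≠ j → P.Joined t i j ω}

/-- `Γ_t(j)`: the number of distinct vertices joined to `j` by at least one edge in `G_t`. -/
noncomputable def nbrCount (t j : ℕ) (ω : P.Ω) : ℕ :=
  ((Finset.Icc 1 t).filter (fun i => P.Joined t i j ω)).card

/-- the time at which vertex `j` is added to the graph. -/
noncomputable def addTime (j : ℕ) (ω : P.Ω) : ℕ := sInf {t | P.nv t ω = j}

/-- at step `s` an edge joining `i` and `j` is added by an edge-step. -/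
def EdgeStepEdge (s i j : ℕ) (ω : P.Ω) : Prop :=
  2 ≤ s ∧ P.Z s ω = false ∧ (P.ep s ω = (i, j) ∨ P.ep s ω = (j, i))

/-- at step `s` an edge joining `i` and `j` is added by a vertex-step. -/
def VertexStepEdge (s i j : ℕ) (ω : P.Ω) : Prop :=
  2 ≤ s ∧ P.Z s ω = true ∧ (P.ep s ω = (i, j) ∨ P.ep s ω = (j, i))

/-- at step `s` vertex `j` is added by a vertex-step and its attaching edge connects it
to vertex `i`. -/
def AttachEdge (s i j : ℕ) (ω : P.Ω) : Prop :=
  2 ≤ s ∧ P.Z s ω = true ∧ P.ep s ω = (i, j) ∧ P.nv s ω = j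

/-- `i` and `j` are joined in `G_t` by at least one edge created at an edge-step. -/
def EdgeJoined (t i j : ℕ) (ω : P.Ω) : Prop :=
  ∃ s ∈ Finset.Icc 1 t, P.EdgeStepEdge s i j ω

/-- `i` and `j` are joined in `G_t` by at least one edge created at a vertex-step. -/
def VJoined (t i j : ℕ) (ω : P.Ω) : Prop :=
  ∃ s ∈ Finset.Icc 1 t, P.VertexStepEdge s i j ω

/-- `i` and `j` are joined in `G_t`, and exclusively by edges created at vertex-steps. -/
def OnlyVertexJoined (t i j : ℕ) (ω : P.Ω) : Prop :=
  P.Joined t i j ω ∧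
    ∀ s ∈ Finset.Icc 1 t, (P.ep s ω = (i, j) ∨ P.ep s ω = (j, i)) → P.Z s ω = true

end PAProcess

section Helpers

/-- A nonnegative, bounded function which is measurable for the σ-algebra `m`. -/
structure IsBddMeas {Ω : Type} (m : MeasurableSpace Ω) (f : Ω → ℝ) : Prop where
  meas : Measurable[m] f
  nonneg : ∀ ω, 0 ≤ f ω
  bdd : ∃ K : ℝ, ∀ ω, f ω ≤ K

namespace IsBddMeas

variable {Ω : Type} {m m' : MeasurableSpace Ω} {f g : Ω → ℝ}

lemma mono (hf : IsBddMeas m f) (h : m ≤ m') : IsBddMeas m' f :=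
  ⟨hf.meas.mono h le_rfl, hf.nonneg, hf.bdd⟩

lemma mul (hf : IsBddMeas m f) (hg : IsBddMeas m g) : IsBddMeas m (fun ω => f ω * g ω) := by
  obtain ⟨K, hK⟩ := hf.bdd
  obtain ⟨K', hK'⟩ := hg.bdd
  refine ⟨hf.meas.mul hg.meas, fun ω => mul_nonneg (hf.nonneg ω) (hg.nonneg ω), K * K', ?_⟩
  intro ω
  exact mul_le_mul (hK ω) (hK' ω) (hg.nonneg ω) ((hf.nonneg ω).trans (hK ω))

lemma add (hf : IsBddMeas m f) (hg : IsBddMeas m g) : IsBddMeas m (fun ω => f ω + g ω) := by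
  obtain ⟨K, hK⟩ := hf.bdd
  obtain ⟨K', hK'⟩ := hg.bdd
  exact ⟨hf.meas.add hg.meas, fun ω => add_nonneg (hf.nonneg ω) (hg.nonneg ω), K + K',
    fun ω => add_le_add (hK ω) (hK' ω)⟩

lemma const {a : ℝ} (ha : 0 ≤ a) : IsBddMeas m (fun _ => a) :=
  ⟨measurable_const, fun _ => ha, a, fun _ => le_rfl⟩

lemma sum {ι : Type*} (s : Finset ι) {F : ι → Ω → ℝ} (hF : ∀ i ∈ s, IsBddMeas m (F i)) :
    IsBddMeas m (fun ω => ∑ i ∈ s, F i ω) := by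
  induction s using Finset.induction_on with
  | empty => simpa using const (m := m) le_rfl
  | insert a s ha ih =>
    simp only [Finset.sum_insert ha]
    exact (hF a (by simp)).add (ih fun i hi => hF i (by simp [hi]))

lemma indicator {A : Set Ω} (hA : MeasurableSet[m] A) :
    IsBddMeas m (A.indicator (fun _ => (1 : ℝ))) := by
  refine ⟨measurable_const.indicator hA, fun ω => ?_, 1, fun ω => ?_⟩ <;>
    by_cases h : ω ∈ A <;> simp [h]

lemma integrable {μ : @Measure Ω m} [IsFiniteMeasure μ] (hf : IsBddMeas m f) :
    Integrable f μ := by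
  obtain ⟨K, hK⟩ := hf.bdd
  refine Integrable.of_bound hf.meas.aestronglyMeasurable K (Eventually.of_forall fun ω => ?_)
  rw [Real.norm_of_nonneg (hf.nonneg ω)]
  exact hK ω

end IsBddMeas

lemma integral_mul_eq_of_condExp {Ω : Type} {m m0 : MeasurableSpace Ω} {μ : Measure Ω}
    [IsFiniteMeasure μ] (hm : m ≤ m0) {f g φ : Ω → ℝ} (hf : IsBddMeas m f)
    (hg : IsBddMeas m0 g) (h : μ[g|m] =ᵐ[μ] φ) :
    ∫ ω, f ω * g ω ∂μ = ∫ ω, f ω * φ ω ∂μ := by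
  have hfg : Integrable (f * g) μ := ((hf.mono hm).mul hg).integrable
  have h1 := condExp_mul_of_stronglyMeasurable_left hf.meas.stronglyMeasurable hfg hg.integrable
  calc ∫ ω, f ω * g ω ∂μ = ∫ ω, (μ[f * g|m]) ω ∂μ := (integral_condExp hm).symm
    _ = ∫ ω, f ω * φ ω ∂μ := by
      refine integral_congr_ae ?_
      filter_upwards [h1, h] with ω h1 h2
      rw [h1, Pi.mul_apply, h2]

lemma integral_add_const_mul₄ {Ω : Type} {m0 : MeasurableSpace Ω} {μ : Measure Ω}
    {f₀ f₁ f₂ f₃ f₄ : Ω → ℝ} {a₁ a₂ a₃ a₄ : ℝ} (h₀ : Integrable f₀ μ) (h₁ : Integrable f₁ μ)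
    (h₂ : Integrable f₂ μ) (h₃ : Integrable f₃ μ) (h₄ : Integrable f₄ μ) :
    ∫ ω, (f₀ ω + a₁ * f₁ ω + a₂ * f₂ ω + a₃ * f₃ ω + a₄ * f₄ ω) ∂μ =
      ∫ ω, f₀ ω ∂μ + a₁ * ∫ ω, f₁ ω ∂μ + a₂ * ∫ ω, f₂ ω ∂μ + a₃ * ∫ ω, f₃ ω ∂μ +
        a₄ * ∫ ω, f₄ ω ∂μ := by
  have k₁ : Integrable (fun ω => f₀ ω + a₁ * f₁ ω) μ := h₀.add (h₁.const_mul a₁)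
  have k₂ : Integrable (fun ω => f₀ ω + a₁ * f₁ ω + a₂ * f₂ ω) μ := k₁.add (h₂.const_mul a₂)
  have k₃ : Integrable (fun ω => f₀ ω + a₁ * f₁ ω + a₂ * f₂ ω + a₃ * f₃ ω) μ :=
    k₂.add (h₃.const_mul a₃)
  rw [integral_add k₃ (h₄.const_mul a₄), integral_add k₂ (h₃.const_mul a₃),
    integral_add k₁ (h₂.const_mul a₂), integral_add h₀ (h₁.const_mul a₁)]
  simp only [integral_const_mul]

end Helpers

namespace PAProcess

variable {p : ℝ} (P : PAProcess p)

section OneStep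

attribute [local instance] PAProcess.m0 PAProcess.isProb

lemma nv_mono {s t : ℕ} (hs : 1 ≤ s) (hst : s ≤ t) (ω : P.Ω) : P.nv s ω ≤ P.nv t ω := by
  induction t, hst using Nat.le_induction with
  | base => exact le_rfl
  | succ n hn ih => rw [P.nv_succ n (hs.trans hn)]; omega

lemma nv_le {s : ℕ} (hs : 1 ≤ s) (ω : P.Ω) : P.nv s ω ≤ s := by
  induction s, hs using Nat.le_induction with
  | base => rw [P.nv_one]
  | succ n hn ih => rw [P.nv_succ n hn]; split_ifs <;> omega

lemma ep_bounds {s : ℕ} (hs : 1 ≤ s) (ω : P.Ω) :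
    1 ≤ (P.ep s ω).1 ∧ (P.ep s ω).1 ≤ P.nv s ω ∧ 1 ≤ (P.ep s ω).2 ∧
      (P.ep s ω).2 ≤ P.nv s ω := by
  rcases Nat.lt_or_ge 1 s with h | h
  · obtain ⟨n, rfl⟩ : ∃ n, s = n + 1 := ⟨s - 1, by omega⟩
    have hn : 1 ≤ n := by omega
    have h1 := P.nv_succ n hn ω
    cases hZ : P.Z (n + 1) ω
    · have := P.ep_edgeStep n hn ω hZ
      simp [hZ] at h1
      omega
    · have := P.ep_vertexStep n hn ω hZ
      simp [hZ] at h1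
      omega
  · obtain rfl : s = 1 := by omega
    simp [P.ep_one, P.nv_one]

lemma deg_succ (s i : ℕ) (ω : P.Ω) :
    P.deg (s + 1) i ω = P.deg s i ω + ((if (P.ep (s + 1) ω).1 = i then 1 else 0) +
      (if (P.ep (s + 1) ω).2 = i then 1 else 0)) := by
  unfold deg degOf
  rw [Finset.sum_Icc_succ_top (by omega)]

lemma deg_eq_zero {s i : ℕ} (ω : P.Ω) (h : P.nv s ω < i) : P.deg s i ω = 0 := by
  unfold deg degOf
  refine Finset.sum_eq_zero fun r hr => ?_
  rw [Finset.mem_Icc] at hr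
  have h1 := P.ep_bounds hr.1 ω
  have h2 := P.nv_mono hr.1 hr.2 ω
  simp only [show (P.ep r ω).1 ≠ i by omega, show (P.ep r ω).2 ≠ i by omega, if_false]
  rfl

lemma deg_eq_zero_of_lt {s i : ℕ} (ω : P.Ω) (h : s < i) : P.deg s i ω = 0 := by
  rcases Nat.eq_zero_or_pos s with rfl | hs
  · simp [deg, degOf]
  · exact P.deg_eq_zero ω ((P.nv_le hs ω).trans_lt h)

lemma deg_succ_le (s i : ℕ) (ω : P.Ω) : P.deg (s + 1) i ω ≤ P.deg s i ω + 2 := by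
  rw [deg_succ]; split_ifs <;> omega

lemma deg_le (s i : ℕ) (ω : P.Ω) : P.deg s i ω ≤ 2 * s := by
  induction s with
  | zero => simp [deg, degOf]
  | succ n ih => have := P.deg_succ_le n i ω; omega

lemma deg_self_le {i : ℕ} (hi : 1 ≤ i) (ω : P.Ω) : P.deg i i ω ≤ 2 := by
  obtain ⟨n, rfl⟩ : ∃ n, i = n + 1 := ⟨i - 1, by omega⟩
  have := P.deg_succ_le n (n + 1) ω
  rwa [P.deg_eq_zero_of_lt ω (Nat.lt_succ_self n)] at this

lemma sum_deg_le (s n : ℕ) (ω : P.Ω) : ∑ w ∈ Finset.Icc 1 n, P.deg s w ω ≤ 2 * s := by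
  induction s with
  | zero => simp [deg, degOf]
  | succ s ih =>
    simp only [deg_succ, Finset.sum_add_distrib, Finset.sum_ite_eq]
    split_ifs <;> omega

lemma deg_meas (s i : ℕ) : Measurable[P.ℱ s] (P.deg s i) := by
  have : P.deg s i = fun ω => ∑ r ∈ Finset.Icc 1 s,
      ((if (P.ep r ω).1 = i then 1 else 0) + (if (P.ep r ω).2 = i then 1 else 0)) := rfl
  rw [this]
  refine Finset.measurable_sum _ fun r hr => ?_
  have h : Measurable[P.ℱ s] (P.ep r) :=
    (P.ep_meas r).mono (P.ℱ.mono (Finset.mem_Icc.1 hr).2) le_rfl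
  exact (Measurable.of_discrete (f := fun q : ℕ × ℕ =>
    (if q.1 = i then 1 else 0) + (if q.2 = i then 1 else 0))).comp h

/-- Indicator that step `s + 1` is a vertex-step attaching the new vertex to `u`. -/
noncomputable def vInd (s u : ℕ) : P.Ω → ℝ :=
  Set.indicator {ω | P.Z (s + 1) ω = true ∧ P.ep (s + 1) ω = (u, P.nv s ω + 1)}
    (fun _ => (1 : ℝ))

/-- Indicator that step `s + 1` is an edge-step with ordered endpoints `(u, w)`. -/
noncomputable def eInd (s u w : ℕ) : P.Ω → ℝ :=
  Set.indicator {ω | P.Z (s + 1) ω = false ∧ P.ep (s + 1) ω = (u, w)} (fun _ => (1 : ℝ))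

/-- Indicator that step `s + 1` is a vertex-step adding the vertex `x`. -/
noncomputable def birthInd (s x : ℕ) : P.Ω → ℝ :=
  Set.indicator {ω | P.nv s ω + 1 = x ∧ P.Z (s + 1) ω = true} (fun _ => (1 : ℝ))

lemma nv_meas_succ (s : ℕ) : Measurable[P.ℱ (s + 1)] (P.nv s) :=
  (P.nv_meas s).mono (P.ℱ.mono (Nat.le_succ s)) le_rfl

lemma measurableSet_Z (s : ℕ) (b : Bool) : MeasurableSet[P.ℱ s] {ω | P.Z s ω = b} :=
  P.Z_meas s (measurableSet_singleton b)

lemma measurableSet_nv (s x : ℕ) : MeasurableSet[P.ℱ s] {ω | P.nv s ω + 1 = x} :=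
  P.nv_meas s (MeasurableSet.of_discrete (s := {n | n + 1 = x}))

lemma vInd_bddMeas (s u : ℕ) : IsBddMeas (P.ℱ (s + 1)) (P.vInd s u) := by
  refine IsBddMeas.indicator (MeasurableSet.inter (P.measurableSet_Z (s + 1) true) ?_)
  have h : Measurable[P.ℱ (s + 1)] (fun ω => (u, P.nv s ω + 1)) :=
    (Measurable.of_discrete (f := fun n : ℕ => (u, n + 1))).comp (P.nv_meas_succ s)
  exact measurableSet_eq_fun (P.ep_meas (s + 1)) h

lemma eInd_bddMeas (s u w : ℕ) : IsBddMeas (P.ℱ (s + 1)) (P.eInd s u w) :=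
  IsBddMeas.indicator (MeasurableSet.inter (P.measurableSet_Z (s + 1) false)
    (P.ep_meas (s + 1) (measurableSet_singleton (u, w))))

lemma birthInd_bddMeas (s x : ℕ) : IsBddMeas (P.ℱ (s + 1)) (P.birthInd s x) :=
  IsBddMeas.indicator (MeasurableSet.inter
    (P.ℱ.mono (Nat.le_succ s) _ (P.measurableSet_nv s x)) (P.measurableSet_Z (s + 1) true))

variable {P} {f : P.Ω → ℝ} {s : ℕ}

lemma integral_mul_vInd (hs : 1 ≤ s) (hf : IsBddMeas (P.ℱ s) f) (u : ℕ) :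
    ∫ ω, f ω * P.vInd s u ω ∂P.μ = ∫ ω, f ω * (p * (P.deg s u ω : ℝ) / (2 * s)) ∂P.μ :=
  integral_mul_eq_of_condExp (P.ℱ.le s) hf ((P.vInd_bddMeas s u).mono (P.ℱ.le _))
    (P.condLaw_vertex s hs u)

lemma integral_mul_eInd (hs : 1 ≤ s) (hf : IsBddMeas (P.ℱ s) f) (u w : ℕ) :
    ∫ ω, f ω * P.eInd s u w ω ∂P.μ =
      ∫ ω, f ω * ((1 - p) * (P.deg s u ω : ℝ) * (P.deg s w ω : ℝ) / (2 * s) ^ 2) ∂P.μ :=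
  integral_mul_eq_of_condExp (P.ℱ.le s) hf ((P.eInd_bddMeas s u w).mono (P.ℱ.le _))
    (P.condLaw_edge s hs u w)

lemma integral_mul_birthInd (hs : 1 ≤ s) (hf : IsBddMeas (P.ℱ s) f) (x : ℕ) :
    ∫ ω, f ω * P.birthInd s x ω ∂P.μ =
      ∫ ω, f ω * {ω | P.nv s ω + 1 = x}.indicator (fun _ => (1 : ℝ)) ω * p ∂P.μ := by
  rw [← integral_mul_eq_of_condExp (P.ℱ.le s)
    (hf.mul (IsBddMeas.indicator (P.measurableSet_nv s x)))
    ((IsBddMeas.indicator (P.measurableSet_Z (s + 1) true)).mono (P.ℱ.le _))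
    (P.condLaw_Z s hs)]
  refine integral_congr_ae (Eventually.of_forall fun ω => ?_)
  by_cases h1 : P.nv s ω + 1 = x <;> by_cases h2 : P.Z (s + 1) ω = true <;>
    simp [birthInd, h1, h2]

lemma sum_eInd_left (hs : 1 ≤ s) (i : ℕ) (ω : P.Ω) :
    ∑ w ∈ Finset.Icc 1 s, P.eInd s i w ω =
      if P.Z (s + 1) ω = false ∧ (P.ep (s + 1) ω).1 = i then 1 else 0 := by
  split_ifs with h
  · have h1 := P.ep_edgeStep s hs ω h.1
    have h2 := P.nv_le hs ω
    rw [Finset.sum_eq_single_of_mem (P.ep (s + 1) ω).2 (Finset.mem_Icc.2 (by omega))]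
    · simp [eInd, h.1, ← h.2]
    · intro w _ hw
      simp [eInd, Prod.ext_iff, hw.symm]
  · refine Finset.sum_eq_zero fun w _ => ?_
    simp only [eInd, Set.indicator_apply, Set.mem_ofPred_eq, ite_eq_right_iff]
    rintro ⟨h1, h2⟩
    exact absurd ⟨h1, by rw [h2]⟩ h

lemma sum_eInd_right (hs : 1 ≤ s) (i : ℕ) (ω : P.Ω) :
    ∑ w ∈ Finset.Icc 1 s, P.eInd s w i ω =
      if P.Z (s + 1) ω = false ∧ (P.ep (s + 1) ω).2 = i then 1 else 0 := by
  split_ifs with h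
  · have h1 := P.ep_edgeStep s hs ω h.1
    have h2 := P.nv_le hs ω
    rw [Finset.sum_eq_single_of_mem (P.ep (s + 1) ω).1 (Finset.mem_Icc.2 (by omega))]
    · simp [eInd, h.1, ← h.2]
    · intro w _ hw
      simp [eInd, Prod.ext_iff, hw.symm]
  · refine Finset.sum_eq_zero fun w _ => ?_
    simp only [eInd, Set.indicator_apply, Set.mem_ofPred_eq, ite_eq_right_iff]
    rintro ⟨h1, h2⟩
    exact absurd ⟨h1, by rw [h2]⟩ h

lemma pow_max_deg_succ_le (hs : 1 ≤ s) {r : ℝ} (hr : 1 ≤ r) (i : ℕ) (ω : P.Ω) :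
    r ^ max (P.deg (s + 1) i ω) 1 ≤ r ^ max (P.deg s i ω) 1 *
      (1 + (r - 1) * P.vInd s i ω + (r - 1) * ∑ w ∈ Finset.Icc 1 s, P.eInd s i w ω +
        (r - 1) * ∑ w ∈ Finset.Icc 1 s, P.eInd s w i ω + (r - 1) ^ 2 * P.eInd s i i ω) := by
  rw [sum_eInd_left hs, sum_eInd_right hs, deg_succ]
  have key : ∀ k : ℕ, ∀ y : ℝ, r ^ k ≤ y →
      r ^ max (P.deg s i ω + k) 1 ≤ r ^ max (P.deg s i ω) 1 * y := by
    intro k y hy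
    calc r ^ max (P.deg s i ω + k) 1 ≤ r ^ (max (P.deg s i ω) 1 + k) :=
          pow_le_pow_right₀ hr (by omega)
      _ = r ^ max (P.deg s i ω) 1 * r ^ k := pow_add _ _ _
      _ ≤ _ := by gcongr
  cases hZ : P.Z (s + 1) ω
  · have hv : P.vInd s i ω = 0 := by simp [vInd, hZ]
    have he : P.eInd s i i ω =
        if (P.ep (s + 1) ω).1 = i ∧ (P.ep (s + 1) ω).2 = i then 1 else 0 := by
      simp [eInd, hZ, Set.indicator_apply, Prod.ext_iff]
    rw [hv, he]
    apply key
    by_cases h1 : (P.ep (s + 1) ω).1 = i <;> by_cases h2 : (P.ep (s + 1) ω).2 = i <;>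
      simp [h1, h2]
    nlinarith
  · obtain ⟨h1, h2, h3⟩ := P.ep_vertexStep s hs ω hZ
    have he : P.eInd s i i ω = 0 := by simp [eInd, hZ]
    have hv : P.vInd s i ω = if (P.ep (s + 1) ω).1 = i then 1 else 0 := by
      simp [vInd, hZ, Set.indicator_apply, Prod.ext_iff, h1]
    rw [hv, he]
    by_cases hi : i = P.nv s ω + 1
    · have h0 : P.deg s i ω = 0 := P.deg_eq_zero ω (by omega)
      have h4 : (P.ep (s + 1) ω).1 ≠ i := by omega
      simp [h0, h4, h1.trans hi.symm]
    · have h4 : (P.ep (s + 1) ω).2 ≠ i := by omega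
      apply key
      by_cases h5 : (P.ep (s + 1) ω).1 = i <;> simp [h4, h5]

lemma pow_max_deg_bddMeas (s i : ℕ) {r : ℝ} (hr : 1 ≤ r) :
    IsBddMeas (P.ℱ s) (fun ω => r ^ max (P.deg s i ω) 1) := by
  refine ⟨(Measurable.of_discrete (f := fun n : ℕ => r ^ max n 1)).comp (P.deg_meas s i),
    fun ω => by positivity, r ^ (2 * s + 1), fun ω => ?_⟩
  have := P.deg_le s i ω
  exact pow_le_pow_right₀ hr (by omega)

lemma cast_deg_bddMeas (s i : ℕ) : IsBddMeas (P.ℱ s) (fun ω => (P.deg s i ω : ℝ)) := by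
  refine ⟨(Measurable.of_discrete (f := fun n : ℕ => (n : ℝ))).comp (P.deg_meas s i),
    fun ω => by positivity, (2 * s : ℕ), fun ω => ?_⟩
  exact_mod_cast P.deg_le s i ω

lemma integral_mul_sum_eInd_le (hp1 : p < 1) (hs : 1 ≤ s) (hf : IsBddMeas (P.ℱ s) f) (i : ℕ) :
    ∫ ω, f ω * ∑ w ∈ Finset.Icc 1 s, P.eInd s i w ω ∂P.μ ≤
        ∫ ω, f ω * ((1 - p) * ((P.deg s i ω : ℝ) / (2 * s))) ∂P.μ ∧
    ∫ ω, f ω * ∑ w ∈ Finset.Icc 1 s, P.eInd s w i ω ∂P.μ ≤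
        ∫ ω, f ω * ((1 - p) * ((P.deg s i ω : ℝ) / (2 * s))) ∂P.μ := by
  have hs' : (0 : ℝ) < s := by exact_mod_cast hs
  have hq : 0 ≤ 1 - p := by linarith
  have hfi : ∀ u w, Integrable (fun ω => f ω *
      ((1 - p) * (P.deg s u ω : ℝ) * (P.deg s w ω : ℝ) / (2 * s) ^ 2)) P.μ := fun u w =>
    (((hf.mul ((((IsBddMeas.const hq).mul (cast_deg_bddMeas s u)).mul
      (cast_deg_bddMeas s w)).mul (IsBddMeas.const (a := ((2 * s : ℝ) ^ 2)⁻¹)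
        (by positivity)))).mono (P.ℱ.le _)).integrable)
  have hvi : Integrable (fun ω => f ω * ((1 - p) * ((P.deg s i ω : ℝ) / (2 * s)))) P.μ :=
    (((hf.mul ((IsBddMeas.const hq).mul ((cast_deg_bddMeas s i).mul
      (IsBddMeas.const (a := ((2 * s : ℝ))⁻¹) (by positivity))))).mono (P.ℱ.le _)).integrable)
  have hei : ∀ u w, Integrable (fun ω => f ω * P.eInd s u w ω) P.μ := fun u w =>
    (((hf.mono (P.ℱ.le _)).mul ((P.eInd_bddMeas s u w).mono (P.ℱ.le _))).integrable)
  have hsum : ∀ ω, ∑ w ∈ Finset.Icc 1 s, (P.deg s w ω : ℝ) ≤ 2 * s := fun ω => by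
    exact_mod_cast P.sum_deg_le s s ω
  have hpt : ∀ ω, ∑ w ∈ Finset.Icc 1 s,
      f ω * ((1 - p) * (P.deg s i ω : ℝ) * (P.deg s w ω : ℝ) / (2 * s) ^ 2) ≤
        f ω * ((1 - p) * ((P.deg s i ω : ℝ) / (2 * s))) := by
    intro ω
    rw [← Finset.mul_sum, ← Finset.sum_div, ← Finset.mul_sum]
    refine mul_le_mul_of_nonneg_left ?_ (hf.nonneg ω)
    rw [mul_assoc, mul_div_assoc]
    refine mul_le_mul_of_nonneg_left ?_ hq
    rw [div_le_div_iff₀ (by positivity) (by positivity)]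
    have : (P.deg s i ω : ℝ) * (∑ w ∈ Finset.Icc 1 s, (P.deg s w ω : ℝ)) ≤
      P.deg s i ω * (2 * s) := by gcongr; exact hsum ω
    nlinarith
  constructor
  · simp only [Finset.mul_sum]
    rw [integral_finsetSum _ fun w _ => hei i w]
    simp only [integral_mul_eInd hs hf]
    rw [← integral_finsetSum _ fun w _ => hfi i w]
    exact integral_mono (integrable_finsetSum _ fun w _ => hfi i w) hvi hpt
  · simp only [Finset.mul_sum]
    rw [integral_finsetSum _ fun w _ => hei w i]
    simp only [integral_mul_eInd hs hf]
    rw [← integral_finsetSum _ fun w _ => hfi w i]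
    refine integral_mono (integrable_finsetSum _ fun w _ => hfi w i) hvi fun ω => ?_
    refine le_trans (le_of_eq (Finset.sum_congr rfl fun w _ => ?_)) (hpt ω)
    ring

lemma integral_pow_succ_le_quadratic (hp0 : 0 < p) (hp1 : p < 1) (hs : 1 ≤ s) (i : ℕ) {r : ℝ}
    (hr : 1 ≤ r) :
    ∫ ω, r ^ max (P.deg (s + 1) i ω) 1 ∂P.μ ≤
      ∫ ω, r ^ max (P.deg s i ω) 1 *
        (1 + (2 - p) * ((r - 1) * (P.deg s i ω : ℝ) / (2 * s)) +
          (1 - p) * ((r - 1) * (P.deg s i ω : ℝ) / (2 * s)) ^ 2) ∂P.μ := by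
  have hs' : (0 : ℝ) < s := by exact_mod_cast hs
  have hq : 0 ≤ 1 - p := by linarith
  have hr' : 0 ≤ r - 1 := by linarith
  set F : P.Ω → ℝ := fun ω => r ^ max (P.deg s i ω) 1 with hF
  have hf : IsBddMeas (P.ℱ s) F := pow_max_deg_bddMeas s i hr
  have hf0 := hf.mono (P.ℱ.le s)
  have hd := cast_deg_bddMeas (P := P) s i
  have i1 : IsBddMeas P.m0 (fun ω => F ω * P.vInd s i ω) :=
    hf0.mul ((P.vInd_bddMeas s i).mono (P.ℱ.le _))
  have i2 : IsBddMeas P.m0 (fun ω => F ω * ∑ w ∈ Finset.Icc 1 s, P.eInd s i w ω) :=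
    hf0.mul ((IsBddMeas.sum _ fun w _ => P.eInd_bddMeas s i w).mono (P.ℱ.le _))
  have i3 : IsBddMeas P.m0 (fun ω => F ω * ∑ w ∈ Finset.Icc 1 s, P.eInd s w i ω) :=
    hf0.mul ((IsBddMeas.sum _ fun w _ => P.eInd_bddMeas s w i).mono (P.ℱ.le _))
  have i4 : IsBddMeas P.m0 (fun ω => F ω * P.eInd s i i ω) :=
    hf0.mul ((P.eInd_bddMeas s i i).mono (P.ℱ.le _))
  have j1 : Integrable (fun ω => F ω * (p * (P.deg s i ω : ℝ) / (2 * s))) P.μ :=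
    ((hf.mul (((IsBddMeas.const hp0.le).mul hd).mul (IsBddMeas.const (a := ((2 * s : ℝ))⁻¹)
      (by positivity)))).mono (P.ℱ.le _)).integrable
  have j2 : Integrable (fun ω => F ω * ((1 - p) * ((P.deg s i ω : ℝ) / (2 * s)))) P.μ :=
    ((hf.mul ((IsBddMeas.const hq).mul (hd.mul (IsBddMeas.const (a := ((2 * s : ℝ))⁻¹)
      (by positivity))))).mono (P.ℱ.le _)).integrable
  have j4 : Integrable (fun ω => F ω *
      ((1 - p) * (P.deg s i ω : ℝ) * (P.deg s i ω : ℝ) / (2 * s) ^ 2)) P.μ :=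
    ((hf.mul ((((IsBddMeas.const hq).mul hd).mul hd).mul
      (IsBddMeas.const (a := ((2 * s : ℝ) ^ 2)⁻¹) (by positivity)))).mono (P.ℱ.le _)).integrable
  obtain ⟨e2, e3⟩ := integral_mul_sum_eInd_le hp1 hs hf i
  have e1 := integral_mul_vInd hs hf i
  have e4 := integral_mul_eInd hs hf i i
  calc ∫ ω, r ^ max (P.deg (s + 1) i ω) 1 ∂P.μ
      ≤ ∫ ω, (F ω + (r - 1) * (F ω * P.vInd s i ω) +
          (r - 1) * (F ω * ∑ w ∈ Finset.Icc 1 s, P.eInd s i w ω) +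
          (r - 1) * (F ω * ∑ w ∈ Finset.Icc 1 s, P.eInd s w i ω) +
          (r - 1) ^ 2 * (F ω * P.eInd s i i ω)) ∂P.μ := by
        refine integral_mono
          ((pow_max_deg_bddMeas (s + 1) i hr).mono (P.ℱ.le _)).integrable
          ((((hf0.integrable.add (i1.integrable.const_mul _)).add
            (i2.integrable.const_mul _)).add (i3.integrable.const_mul _)).add
            (i4.integrable.const_mul _)) fun ω => ?_
        refine (pow_max_deg_succ_le hs hr i ω).trans (le_of_eq ?_)
        simp only [hF]
        ring
    _ = ∫ ω, F ω ∂P.μ + (r - 1) * ∫ ω, F ω * P.vInd s i ω ∂P.μ +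
          (r - 1) * ∫ ω, F ω * ∑ w ∈ Finset.Icc 1 s, P.eInd s i w ω ∂P.μ +
          (r - 1) * ∫ ω, F ω * ∑ w ∈ Finset.Icc 1 s, P.eInd s w i ω ∂P.μ +
          (r - 1) ^ 2 * ∫ ω, F ω * P.eInd s i i ω ∂P.μ := by
        exact integral_add_const_mul₄ hf0.integrable i1.integrable i2.integrable i3.integrable
          i4.integrable
    _ ≤ ∫ ω, F ω ∂P.μ + (r - 1) * ∫ ω, F ω * (p * (P.deg s i ω : ℝ) / (2 * s)) ∂P.μ +
          (r - 1) * ∫ ω, F ω * ((1 - p) * ((P.deg s i ω : ℝ) / (2 * s))) ∂P.μ +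
          (r - 1) * ∫ ω, F ω * ((1 - p) * ((P.deg s i ω : ℝ) / (2 * s))) ∂P.μ +
          (r - 1) ^ 2 * ∫ ω, F ω *
            ((1 - p) * (P.deg s i ω : ℝ) * (P.deg s i ω : ℝ) / (2 * s) ^ 2) ∂P.μ := by
        rw [e1, e4]
        gcongr
    _ = _ := by
        rw [← integral_add_const_mul₄ hf0.integrable j1 j2 j2 j4]
        refine integral_congr_ae (Eventually.of_forall fun ω => ?_)
        simp only [hF]
        field_simp
        ring

end OneStep

end PAProcess

section Scalar

lemma inv_one_sub_mul_exp_le {g g' y : ℝ} (hg : g < 1) (hg' : g' < 1)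
    (h : g * (1 + y) ≤ g') :
    (1 - g)⁻¹ * Real.exp (y * ((1 - g)⁻¹ - 1)) ≤ (1 - g')⁻¹ := by
  have h1 : 0 < 1 - g := by linarith
  have h2 : 0 < 1 - g' := by linarith
  rw [le_inv_comm₀ (by positivity) h2, mul_inv, inv_inv, ← Real.exp_neg]
  have h3 : (1 - g) * (y * ((1 - g)⁻¹ - 1)) = y * g := by field_simp; ring
  have h4 := mul_le_mul_of_nonneg_left (Real.add_one_le_exp (-(y * ((1 - g)⁻¹ - 1)))) h1.le
  nlinarith

lemma pow_mul_quadratic_le {p g g' : ℝ} {s d : ℕ} (hs : 1 ≤ s) (hp1 : p < 1) (hg0 : 0 ≤ g)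
    (hg : g < 1) (hg' : g' < 1) (h : g * (1 + (1 - p / 2) / s) ≤ g') :
    (1 - g)⁻¹ ^ max d 1 * (1 + (2 - p) * (((1 - g)⁻¹ - 1) * (d : ℝ) / (2 * s)) +
          (1 - p) * (((1 - g)⁻¹ - 1) * (d : ℝ) / (2 * s)) ^ 2) ≤ (1 - g')⁻¹ ^ max d 1 := by
  have hs' : (0 : ℝ) < s := by exact_mod_cast hs
  have h1 : 0 < 1 - g := by linarith
  have hr : 1 ≤ (1 - g)⁻¹ := (one_le_inv₀ h1).2 (by linarith)
  have hr0 : 0 ≤ (1 - g)⁻¹ - 1 := by linarith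
  set u := ((1 - g)⁻¹ - 1) * (d : ℝ) / (2 * s) with hu
  have hu0 : 0 ≤ u := by positivity
  have h2 : 1 + (2 - p) * u + (1 - p) * u ^ 2 ≤ Real.exp ((2 - p) * u) := by
    have := Real.quadratic_le_exp_of_nonneg (x := (2 - p) * u)
      (mul_nonneg (by linarith) hu0)
    nlinarith [sq_nonneg u, mul_nonneg (sq_nonneg u) (sq_nonneg (1 - p))]
  set y := (1 - p / 2) / (s : ℝ) with hy
  have h3 : (2 - p) * u ≤ (max d 1 : ℕ) * (y * ((1 - g)⁻¹ - 1)) := by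
    have : (2 - p) * u = d * (y * ((1 - g)⁻¹ - 1)) := by
      rw [hu, hy]; field_simp
    rw [this]
    have hy0 : 0 ≤ y := div_nonneg (by linarith) hs'.le
    gcongr
    exact le_max_left _ _
  calc _ ≤ (1 - g)⁻¹ ^ max d 1 * Real.exp ((max d 1 : ℕ) * (y * ((1 - g)⁻¹ - 1))) := by
        gcongr
        exact h2.trans (Real.exp_le_exp.2 h3)
    _ = ((1 - g)⁻¹ * Real.exp (y * ((1 - g)⁻¹ - 1))) ^ max d 1 := by
        rw [mul_pow, Real.exp_nat_mul]
    _ ≤ _ := by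
        gcongr
        exact inv_one_sub_mul_exp_le hg hg' h

lemma div_rpow_step {c x : ℝ} {s : ℕ} (hc0 : 0 ≤ c) (hc1 : c ≤ 1) (hx : 0 ≤ x) (hs : 2 ≤ s) :
    (x / s) ^ c * (1 + c / s) ≤ (x / ((s : ℝ) - 1)) ^ c := by
  have hs' : (2 : ℝ) ≤ s := by exact_mod_cast hs
  have h0 : (0 : ℝ) < s := by linarith
  have h1 : (0 : ℝ) < s - 1 := by linarith
  have e : x / s = x / ((s : ℝ) - 1) * (1 + -(1 / s)) := by field_simp; ring
  have hi : 1 / (s : ℝ) ≤ 1 := by rw [div_le_one h0]; linarith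
  rw [e, Real.mul_rpow (by positivity) (by linarith), mul_assoc]
  refine mul_le_of_le_one_right (by positivity) ?_
  have hb := rpow_one_add_le_one_add_mul_self (s := -(1 / (s : ℝ))) (by linarith) hc0 hc1
  have hcs : 0 ≤ c / s := by positivity
  calc (1 + -(1 / (s : ℝ))) ^ c * (1 + c / s) ≤ (1 + c * -(1 / (s : ℝ))) * (1 + c / s) := by
        gcongr
    _ = 1 - (c / s) ^ 2 := by ring
    _ ≤ 1 := by nlinarith [sq_nonneg (c / s)]

end Scalar

namespace PAProcess

variable {p : ℝ} {P : PAProcess p} {f : P.Ω → ℝ} {s : ℕ}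

section Tail

attribute [local instance] PAProcess.m0 PAProcess.isProb

/-- The parameter `g_s` for which `(1 - g_s)⁻¹ ^ d_s(i)` has non-increasing expectation. -/
noncomputable def tailParam (p : ℝ) (i s : ℕ) : ℝ :=
  1 / 2 * ((i : ℝ) / ((s : ℝ) - 1)) ^ (1 - p / 2)

lemma tailParam_nonneg {i : ℕ} (hs : 1 ≤ s) : 0 ≤ tailParam p i s := by
  have : (1 : ℝ) ≤ s := by exact_mod_cast hs
  have : (0 : ℝ) ≤ s - 1 := by linarith
  unfold tailParam
  positivity

lemma tailParam_le {i : ℕ} (hp1 : p < 1) (h : i + 1 ≤ s) : tailParam p i s ≤ 1 / 2 := by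
  have h' : (i : ℝ) + 1 ≤ s := by exact_mod_cast h
  unfold tailParam
  have : ((i : ℝ) / ((s : ℝ) - 1)) ^ (1 - p / 2) ≤ 1 := by
    refine Real.rpow_le_one ?_ ?_ (by linarith)
    · exact div_nonneg (by positivity) (by linarith [(Nat.cast_nonneg i : (0 : ℝ) ≤ i)])
    · exact div_le_one_of_le₀ (by linarith) (by linarith [(Nat.cast_nonneg i : (0 : ℝ) ≤ i)])
  linarith

lemma one_le_inv_tailParam {i : ℕ} (hp1 : p < 1) (h : i + 1 ≤ s) :
    1 ≤ (1 - tailParam p i s)⁻¹ := by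
  have h1 := tailParam_le hp1 h
  have h2 := tailParam_nonneg (p := p) (i := i) (s := s) (by omega)
  exact (one_le_inv₀ (by linarith)).2 (by linarith)

lemma integral_tail_pow_le (hp0 : 0 < p) (hp1 : p < 1) {i : ℕ} (hi : 1 ≤ i) (h : i + 1 ≤ s) :
    ∫ ω, (1 - tailParam p i s)⁻¹ ^ max (P.deg s i ω) 1 ∂P.μ ≤ 16 := by
  induction s, h using Nat.le_induction with
  | base =>
    have e : tailParam p i (i + 1) = 1 / 2 := by
      have : (i : ℝ) ≠ 0 := by positivity
      simp [tailParam, this]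
    rw [e]
    calc ∫ ω, (1 - 1 / 2 : ℝ)⁻¹ ^ max (P.deg (i + 1) i ω) 1 ∂P.μ ≤ ∫ ω, (16 : ℝ) ∂P.μ := by
          refine integral_mono ((pow_max_deg_bddMeas (i + 1) i (by norm_num)).mono
            (P.ℱ.le _)).integrable (integrable_const _) fun ω => ?_
          have h1 := P.deg_succ_le i i ω
          have h2 := P.deg_self_le hi ω
          calc (1 - 1 / 2 : ℝ)⁻¹ ^ max (P.deg (i + 1) i ω) 1 ≤ (1 - 1 / 2 : ℝ)⁻¹ ^ 4 :=
                pow_le_pow_right₀ (by norm_num) (by omega)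
            _ = 16 := by norm_num
      _ = 16 := by simp
  | succ s h ih =>
    refine le_trans ?_ ih
    have hs : 1 ≤ s := by omega
    refine (integral_pow_succ_le_quadratic hp0 hp1 hs i
      (one_le_inv_tailParam hp1 (by omega))).trans ?_
    have hle := tailParam_le (s := s) hp1 h
    have hle' := tailParam_le (i := i) (s := s + 1) hp1 (by omega)
    refine integral_mono_of_nonneg (Eventually.of_forall fun ω => ?_)
      ((pow_max_deg_bddMeas s i (one_le_inv_tailParam hp1 h)).mono (P.ℱ.le _)).integrable
      (Eventually.of_forall fun ω => ?_)
    · have h1 := one_le_inv_tailParam (i := i) (s := s + 1) hp1 (by omega)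
      have h2 : 0 ≤ (1 - tailParam p i (s + 1))⁻¹ - 1 := by linarith
      have h3 : 0 ≤ 1 - p := by linarith
      have h4 : 0 ≤ 2 - p := by linarith
      simp only [Pi.zero_apply]
      positivity
    · refine pow_mul_quadratic_le hs hp1 (tailParam_nonneg (by omega)) (by linarith)
        (by linarith) ?_
      have := div_rpow_step (c := 1 - p / 2) (x := i) (s := s) (by linarith) (by linarith)
        (by positivity) (by omega)
      unfold tailParam
      push_cast
      rw [add_sub_cancel_right]
      linarith

lemma one_le_exp_mul_tail_pow (hp1 : p < 1) {i : ℕ} (hi : 1 ≤ i) (h : i + 1 ≤ s) {L : ℝ} {d : ℕ}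
    (hL : 0 ≤ L) (hd : L * ((s : ℝ) / i) ^ (1 - p / 2) < d) :
    1 ≤ Real.exp (-(L / 2)) * (1 - tailParam p i s)⁻¹ ^ max d 1 := by
  have hi' : (1 : ℝ) ≤ i := by exact_mod_cast hi
  have hs' : (i : ℝ) + 1 ≤ s := by exact_mod_cast h
  have hle := tailParam_le (p := p) (s := s) hp1 h
  have h0 := tailParam_nonneg (p := p) (i := i) (s := s) (by omega)
  set g := tailParam p i s with hg
  have h1 : Real.exp g ≤ (1 - g)⁻¹ := by
    rw [le_inv_comm₀ (Real.exp_pos _) (by linarith), ← Real.exp_neg]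
    linarith [Real.add_one_le_exp (-g)]
  have h2 : L / 2 ≤ g * (max d 1 : ℕ) := by
    have h3 : ((s : ℝ) / i) ^ (1 - p / 2) * ((i : ℝ) / (s - 1)) ^ (1 - p / 2) ≥ 1 := by
      rw [← Real.mul_rpow (by positivity) (div_nonneg (by positivity) (by linarith))]
      refine Real.one_le_rpow ?_ (by linarith)
      rw [div_mul_div_comm, one_le_div (mul_pos (by linarith) (by linarith))]
      nlinarith
    have h4 : (d : ℝ) ≤ (max d 1 : ℕ) := by exact_mod_cast le_max_left _ _
    calc L / 2 ≤ 1 / 2 * (L * (((s : ℝ) / i) ^ (1 - p / 2) *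
          ((i : ℝ) / (s - 1)) ^ (1 - p / 2))) := by nlinarith
      _ = g * (L * ((s : ℝ) / i) ^ (1 - p / 2)) := by rw [hg, tailParam]; ring
      _ ≤ g * (max d 1 : ℕ) := by gcongr; linarith
  calc (1 : ℝ) = Real.exp (-(L / 2)) * Real.exp (L / 2) := by rw [← Real.exp_add]; simp
    _ ≤ Real.exp (-(L / 2)) * Real.exp (g * (max d 1 : ℕ)) := by gcongr
    _ = Real.exp (-(L / 2)) * Real.exp g ^ max d 1 := by
        rw [mul_comm g, Real.exp_nat_mul]
    _ ≤ _ := by gcongr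

end Tail

end PAProcess

section Sums

lemma sum_rpow_neg_le {p : ℝ} (hp0 : 0 < p) (hp1 : p < 1) (n : ℕ) :
    ∑ s ∈ Finset.Icc 1 n, (s : ℝ) ^ (-p) ≤ (n : ℝ) ^ (1 - p) / (1 - p) := by
  have hq : 0 < 1 - p := by linarith
  induction n with
  | zero => simp [Real.zero_rpow hq.ne']
  | succ n ih =>
    rw [Finset.sum_Icc_succ_top (by omega)]
    refine (add_le_add_left ih _).trans ?_
    have hm : (0 : ℝ) < (n + 1 : ℕ) := by positivity
    set m : ℝ := ((n + 1 : ℕ) : ℝ) with hmdef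
    have e : (n : ℝ) = m * (1 + -(1 / m)) := by
      rw [hmdef]; push_cast; field_simp; ring
    have h1 : 1 / m ≤ 1 := by
      rw [div_le_one hm, hmdef]; push_cast; linarith [(Nat.cast_nonneg n : (0 : ℝ) ≤ n)]
    have hb := rpow_one_add_le_one_add_mul_self (s := -(1 / m)) (by linarith) hq.le
      (by linarith)
    have e2 : m ^ (1 - p) = m * m ^ (-p) := by
      rw [sub_eq_add_neg, Real.rpow_add hm, Real.rpow_one]
    rw [e, Real.mul_rpow hm.le (by linarith), ← le_sub_iff_add_le, div_le_iff₀ hq, sub_mul,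
      div_mul_cancel₀ _ hq.ne']
    calc m ^ (1 - p) * (1 + -(1 / m)) ^ (1 - p)
        ≤ m ^ (1 - p) * (1 + (1 - p) * -(1 / m)) := by gcongr
      _ = _ := by rw [e2]; field_simp; ring

lemma sum_inv_le_log {n : ℕ} (hn : 2 ≤ n) :
    ∑ s ∈ Finset.Icc 1 n, (s : ℝ)⁻¹ ≤ 3 * Real.log n := by
  have h := harmonic_le_one_add_log n
  rw [harmonic_eq_sum_Icc] at h
  push_cast at h
  have h2 : Real.log 2 ≤ Real.log n := Real.log_le_log (by norm_num) (by exact_mod_cast hn)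
  linarith [Real.log_two_gt_d9]

end Sums

namespace PAProcess

variable {p : ℝ} (P : PAProcess p)

section Triples

attribute [local instance] PAProcess.m0 PAProcess.isProb

/-- The event that at time `s` all degrees are at most `L (s / i) ^ (1 - p / 2)`. -/
def good (L : ℝ) (t s : ℕ) : Set P.Ω :=
  {ω | ∀ i ∈ Finset.Icc 1 t, (P.deg s i ω : ℝ) ≤ L * ((s : ℝ) / i) ^ (1 - p / 2)}

lemma measurableSet_good (L : ℝ) (t s : ℕ) : MeasurableSet[P.ℱ s] (P.good L t s) := by
  have : P.good L t s = ⋂ i ∈ Finset.Icc 1 t,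
      {ω | (P.deg s i ω : ℝ) ≤ L * ((s : ℝ) / i) ^ (1 - p / 2)} := by
    ext ω; simp [good]
  rw [this]
  refine Finset.measurableSet_biInter _ fun i _ => ?_
  exact (cast_deg_bddMeas s i).meas measurableSet_Iic

/-- Indicator of `good`. -/
noncomputable def goodInd (L : ℝ) (t s : ℕ) : P.Ω → ℝ :=
  (P.good L t s).indicator (fun _ => (1 : ℝ))

lemma goodInd_bddMeas (L : ℝ) (t s : ℕ) : IsBddMeas (P.ℱ s) (P.goodInd L t s) :=
  IsBddMeas.indicator (P.measurableSet_good L t s)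

/-- Indicator that degrees are good at time `s` and that step `s + 1` is an edge-step joining
`a` and `b` (an edge-step loop is counted twice). -/
noncomputable def goodEdge (L : ℝ) (t s a b : ℕ) (ω : P.Ω) : ℝ :=
  P.goodInd L t s ω * (P.eInd s a b ω + P.eInd s b a ω)

/-- Indicator that degrees are good at time `s` and that step `s + 1` adds the vertex `x`,
attached to `y`. -/
noncomputable def goodAttach (L : ℝ) (t s x y : ℕ) (ω : P.Ω) : ℝ :=
  P.goodInd L t s ω * {ω | P.nv s ω + 1 = x}.indicator (fun _ => (1 : ℝ)) ω * P.vInd s y ω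

lemma goodEdge_bddMeas (L : ℝ) (t s a b : ℕ) :
    IsBddMeas (P.ℱ (s + 1)) (P.goodEdge L t s a b) :=
  ((P.goodInd_bddMeas L t s).mono (P.ℱ.mono (Nat.le_succ s))).mul
    ((P.eInd_bddMeas s a b).add (P.eInd_bddMeas s b a))

lemma goodAttach_bddMeas (L : ℝ) (t s x y : ℕ) :
    IsBddMeas (P.ℱ (s + 1)) (P.goodAttach L t s x y) :=
  (((P.goodInd_bddMeas L t s).mul (IsBddMeas.indicator (P.measurableSet_nv s x))).mono
    (P.ℱ.mono (Nat.le_succ s))).mul (P.vInd_bddMeas s y)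

/-- Bound for the conditional probability of a good edge-step between `a` and `b`. -/
noncomputable def edgeRate (p L : ℝ) (a b s : ℕ) : ℝ :=
  L ^ 2 / 2 * (((s : ℝ) / a) ^ (1 - p / 2) * ((s : ℝ) / b) ^ (1 - p / 2) / (s : ℝ) ^ 2)

/-- Bound for the conditional probability that `x` is attached to `y`. -/
noncomputable def attachRate (p L : ℝ) (x y : ℕ) : ℝ :=
  L * ((x : ℝ) ^ (-(p / 2)) / (y : ℝ) ^ (1 - p / 2))

lemma edgeRate_nonneg (p L : ℝ) (a b s : ℕ) : 0 ≤ edgeRate p L a b s := by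
  unfold edgeRate; positivity

lemma attachRate_nonneg {p L : ℝ} (hL : 0 ≤ L) (x y : ℕ) : 0 ≤ attachRate p L x y := by
  unfold attachRate; positivity

variable {P} {f : P.Ω → ℝ} {L : ℝ} {t s : ℕ}

lemma integral_mul_goodEdge_le (hp0 : 0 < p) (hp1 : p < 1) (hL : 0 ≤ L) (hs : 1 ≤ s)
    (hf : IsBddMeas (P.ℱ s) f) {a b : ℕ} (ha : a ∈ Finset.Icc 1 t) (hb : b ∈ Finset.Icc 1 t) :
    ∫ ω, f ω * P.goodEdge L t s a b ω ∂P.μ ≤ edgeRate p L a b s * ∫ ω, f ω ∂P.μ := by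
  have hs' : (0 : ℝ) < s := by exact_mod_cast hs
  have hq : 0 ≤ 1 - p := by linarith
  have hF := hf.mul (P.goodInd_bddMeas L t s)
  have hi : ∀ u w, Integrable (fun ω => f ω * P.goodInd L t s ω * P.eInd s u w ω) P.μ :=
    fun u w => ((hF.mono (P.ℱ.le _)).mul ((P.eInd_bddMeas s u w).mono (P.ℱ.le _))).integrable
  have hj : ∀ u w, Integrable (fun ω => f ω * P.goodInd L t s ω *
      ((1 - p) * (P.deg s u ω : ℝ) * (P.deg s w ω : ℝ) / (2 * s) ^ 2)) P.μ := fun u w =>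
    ((hF.mul ((((IsBddMeas.const hq).mul (cast_deg_bddMeas s u)).mul
      (cast_deg_bddMeas s w)).mul (IsBddMeas.const (a := ((2 * s : ℝ) ^ 2)⁻¹)
        (by positivity)))).mono (P.ℱ.le _)).integrable
  have e : ∀ ω, f ω * P.goodEdge L t s a b ω =
      f ω * P.goodInd L t s ω * P.eInd s a b ω + f ω * P.goodInd L t s ω * P.eInd s b a ω := by
    intro ω; rw [goodEdge]; ring
  simp only [e]
  rw [integral_add (hi a b) (hi b a), integral_mul_eInd hs hF, integral_mul_eInd hs hF,
    ← integral_add (hj a b) (hj b a), ← integral_const_mul]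
  refine integral_mono ((hj a b).add (hj b a))
    ((hf.mono (P.ℱ.le _)).integrable.const_mul _) fun ω => ?_
  by_cases hg : ω ∈ P.good L t s
  · have h1 := hg a ha
    have h2 := hg b hb
    have hprod : (P.deg s a ω : ℝ) * P.deg s b ω ≤ (L * ((s : ℝ) / a) ^ (1 - p / 2)) *
        (L * ((s : ℝ) / b) ^ (1 - p / 2)) := by gcongr
    have h3 : (1 - p) * ((P.deg s a ω : ℝ) * P.deg s b ω) ≤
        1 * ((L * ((s : ℝ) / a) ^ (1 - p / 2)) * (L * ((s : ℝ) / b) ^ (1 - p / 2))) :=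
      mul_le_mul (by linarith) hprod (by positivity) (by norm_num)
    simp only [goodInd, Set.indicator_of_mem hg, mul_one]
    rw [← mul_add, mul_comm (edgeRate p L a b s)]
    refine mul_le_mul_of_nonneg_left ?_ (hf.nonneg ω)
    rw [← add_div, div_le_iff₀ (by positivity)]
    have e3 : edgeRate p L a b s * (2 * s) ^ 2 =
        2 * ((L * ((s : ℝ) / a) ^ (1 - p / 2)) * (L * ((s : ℝ) / b) ^ (1 - p / 2))) := by
      unfold edgeRate; field_simp
    rw [e3]
    linarith
  · simp only [goodInd, Set.indicator_of_notMem hg, mul_zero, zero_mul, add_zero]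
    exact mul_nonneg (edgeRate_nonneg _ _ _ _ _) (hf.nonneg ω)

lemma div_two_mul_rpow_le (hp0 : 0 < p) (hp1 : p < 1) {x y : ℕ} (hx : 1 ≤ x) (hs : 1 ≤ s)
    (hxs : x ≤ s + 1) :
    ((s : ℝ) / y) ^ (1 - p / 2) / (2 * s) ≤ (x : ℝ) ^ (-(p / 2)) / (y : ℝ) ^ (1 - p / 2) := by
  have hs' : (0 : ℝ) < s := by exact_mod_cast hs
  have hx' : (0 : ℝ) < x := by exact_mod_cast hx
  have hxs' : (x : ℝ) ≤ 2 * s := by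
    have : x ≤ 2 * s := by omega
    exact_mod_cast this
  rw [Real.div_rpow hs'.le (by positivity), div_right_comm]
  refine div_le_div_of_nonneg_right ?_ (by positivity)
  have e : (s : ℝ) ^ (1 - p / 2) = s * (s : ℝ) ^ (-(p / 2)) := by
    rw [sub_eq_add_neg, Real.rpow_add hs', Real.rpow_one]
  have h1 : (2 * (s : ℝ)) ^ (-(p / 2)) ≤ (x : ℝ) ^ (-(p / 2)) :=
    Real.rpow_le_rpow_of_nonpos hx' hxs' (by linarith)
  have h2 : (1 / 2 : ℝ) ≤ 2 ^ (-(p / 2)) := by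
    calc (1 / 2 : ℝ) = 2 ^ (-1 : ℝ) := by rw [Real.rpow_neg_one]; norm_num
      _ ≤ _ := Real.rpow_le_rpow_of_exponent_le (by norm_num) (by linarith)
  rw [Real.mul_rpow (by norm_num) hs'.le] at h1
  refine le_trans ?_ h1
  rw [e, mul_comm (2 : ℝ), mul_div_mul_left _ _ hs'.ne']
  nlinarith [Real.rpow_pos_of_pos hs' (-(p / 2))]

lemma integral_mul_goodAttach_le (hp0 : 0 < p) (hp1 : p < 1) (hL : 0 ≤ L) (hs : 1 ≤ s)
    (hf : IsBddMeas (P.ℱ s) f) {x y : ℕ} (hy : y ∈ Finset.Icc 1 t) :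
    ∫ ω, f ω * P.goodAttach L t s x y ω ∂P.μ ≤
      attachRate p L x y * ∫ ω, f ω * P.birthInd s x ω ∂P.μ := by
  have hs' : (0 : ℝ) < s := by exact_mod_cast hs
  have hN : IsBddMeas (P.ℱ s) ({ω | P.nv s ω + 1 = x}.indicator (fun _ => (1 : ℝ))) :=
    IsBddMeas.indicator (P.measurableSet_nv s x)
  have hF := hf.mul ((P.goodInd_bddMeas L t s).mul hN)
  have e : ∀ ω, f ω * P.goodAttach L t s x y ω =
      f ω * (P.goodInd L t s ω * {ω | P.nv s ω + 1 = x}.indicator (fun _ => (1 : ℝ)) ω) *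
        P.vInd s y ω := by
    intro ω; rw [goodAttach]; ring
  simp only [e]
  rw [integral_mul_vInd hs hF, integral_mul_birthInd hs hf, ← integral_const_mul]
  refine integral_mono
    ((hF.mul (((IsBddMeas.const hp0.le).mul (cast_deg_bddMeas s y)).mul
      (IsBddMeas.const (a := ((2 * s : ℝ))⁻¹) (by positivity)))).mono (P.ℱ.le _)).integrable
    ((((hf.mul hN).mul (IsBddMeas.const hp0.le)).mono (P.ℱ.le _)).integrable.const_mul _) ?_
  intro ω
  have hA := attachRate_nonneg (p := p) hL x y
  have hf0 := hf.nonneg ω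
  by_cases hn : P.nv s ω + 1 = x
  · by_cases hg : ω ∈ P.good L t s
    · have h1 := hg y hy
      have h2 := div_two_mul_rpow_le (y := y) hp0 hp1 (x := x) (by omega) hs
        (by have := P.nv_le hs ω; omega)
      have h3 : (P.deg s y ω : ℝ) / (2 * s) ≤ attachRate p L x y := by
        calc (P.deg s y ω : ℝ) / (2 * s) ≤ L * ((s : ℝ) / y) ^ (1 - p / 2) / (2 * s) := by
              gcongr
          _ = L * (((s : ℝ) / y) ^ (1 - p / 2) / (2 * s)) := by ring
          _ ≤ _ := mul_le_mul_of_nonneg_left h2 hL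
      simp only [goodInd, Set.indicator_of_mem hg, Set.indicator_apply, Set.mem_ofPred_eq, hn,
        if_true, mul_one]
      calc f ω * (p * (P.deg s y ω : ℝ) / (2 * s)) =
            f ω * (p * ((P.deg s y ω : ℝ) / (2 * s))) := by ring
        _ ≤ f ω * (p * attachRate p L x y) := by gcongr
        _ = _ := by ring
    · simp only [goodInd, Set.indicator_of_notMem hg, Set.indicator_apply, Set.mem_ofPred_eq, hn,
        if_true, mul_one, mul_zero, zero_mul]
      positivity
  · simp [hn]

lemma sum_birthInd_le (x n : ℕ) (ω : P.Ω) :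
    ∑ s ∈ Finset.Ico 1 n, P.birthInd s x ω ≤ 1 := by
  rcases Nat.eq_zero_or_pos n with rfl | hn
  · simp
  suffices h : ∑ s ∈ Finset.Ico 1 n, P.birthInd s x ω ≤ if x ≤ P.nv n ω then 1 else 0 by
    refine h.trans ?_
    split_ifs <;> norm_num
  induction n, hn using Nat.le_induction with
  | base => simp only [Finset.Ico_self, Finset.sum_empty]; split_ifs <;> norm_num
  | succ n hn ih =>
    rw [Finset.sum_Ico_succ_top hn]
    have h1 := P.nv_succ n hn ω
    by_cases hx : P.nv n ω + 1 = x ∧ P.Z (n + 1) ω = true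
    · have hb : P.birthInd n x ω = 1 := by simp [birthInd, hx.1, hx.2]
      rw [if_neg (by omega)] at ih
      rw [hx.2, if_pos rfl] at h1
      rw [hb, if_pos (by omega)]
      linarith
    · have hb : P.birthInd n x ω = 0 := by
        rw [birthInd, Set.indicator_of_notMem]
        exact hx
      rw [hb, add_zero]
      refine ih.trans ?_
      by_cases h2 : x ≤ P.nv n ω
      · rw [if_pos h2, if_pos (h2.trans (by omega))]
      · rw [if_neg h2]; split_ifs <;> norm_num

lemma sum_integral_mul_birthInd_le (hf : IsBddMeas P.m0 f) (x n : ℕ) :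
    ∑ s ∈ Finset.Ico 1 n, ∫ ω, f ω * P.birthInd s x ω ∂P.μ ≤ ∫ ω, f ω ∂P.μ := by
  have hi : ∀ s ∈ Finset.Ico 1 n, IsBddMeas P.m0 (fun ω => f ω * P.birthInd s x ω) :=
    fun s _ => hf.mul ((P.birthInd_bddMeas s x).mono (P.ℱ.le _))
  rw [← integral_finsetSum _ fun s hs => (hi s hs).integrable]
  refine integral_mono (IsBddMeas.sum _ hi).integrable hf.integrable fun ω => ?_
  simp only [← Finset.mul_sum]
  exact mul_le_of_le_one_right (hf.nonneg ω) (sum_birthInd_le x n ω)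

variable (P)

/-- Triples of steps, in order: `x` is attached to `y`, then an `a b` edge-step, then an
`a' b'` edge-step. -/
noncomputable def attachFirst (L : ℝ) (t x y a b a' b' : ℕ) (ω : P.Ω) : ℝ :=
  ∑ s₁ ∈ Finset.Ico 1 t, ∑ s₂ ∈ Finset.Ico 1 t, ∑ s₃ ∈ Finset.Ico 1 t,
    if s₁ < s₂ ∧ s₂ < s₃ then
      P.goodAttach L t s₁ x y ω * P.goodEdge L t s₂ a b ω * P.goodEdge L t s₃ a' b' ω else 0

/-- Triples of steps, in order: an `a b` edge-step, then `x` is attached to `y`, then an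
`a' b'` edge-step. -/
noncomputable def attachSecond (L : ℝ) (t x y a b a' b' : ℕ) (ω : P.Ω) : ℝ :=
  ∑ s₂ ∈ Finset.Ico 1 t, ∑ s₃ ∈ Finset.Ico 1 t, ∑ s₁ ∈ Finset.Ico 1 t,
    if s₂ < s₁ ∧ s₁ < s₃ then
      P.goodEdge L t s₂ a b ω * P.goodAttach L t s₁ x y ω * P.goodEdge L t s₃ a' b' ω else 0

variable {P}

lemma bddMeas_ite_attachFirst (L : ℝ) (t x y a b a' b' s₁ s₂ s₃ : ℕ) :
    IsBddMeas P.m0 (fun ω => if s₁ < s₂ ∧ s₂ < s₃ then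
      P.goodAttach L t s₁ x y ω * P.goodEdge L t s₂ a b ω * P.goodEdge L t s₃ a' b' ω
      else 0) := by
  split_ifs
  · exact (((P.goodAttach_bddMeas L t s₁ x y).mono (P.ℱ.le _)).mul
      ((P.goodEdge_bddMeas L t s₂ a b).mono (P.ℱ.le _))).mul
      ((P.goodEdge_bddMeas L t s₃ a' b').mono (P.ℱ.le _))
  · exact IsBddMeas.const le_rfl

lemma bddMeas_ite_attachSecond (L : ℝ) (t x y a b a' b' s₁ s₂ s₃ : ℕ) :
    IsBddMeas P.m0 (fun ω => if s₂ < s₁ ∧ s₁ < s₃ then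
      P.goodEdge L t s₂ a b ω * P.goodAttach L t s₁ x y ω * P.goodEdge L t s₃ a' b' ω
      else 0) := by
  split_ifs
  · exact (((P.goodEdge_bddMeas L t s₂ a b).mono (P.ℱ.le _)).mul
      ((P.goodAttach_bddMeas L t s₁ x y).mono (P.ℱ.le _))).mul
      ((P.goodEdge_bddMeas L t s₃ a' b').mono (P.ℱ.le _))
  · exact IsBddMeas.const le_rfl

lemma attachFirst_bddMeas (L : ℝ) (t x y a b a' b' : ℕ) :
    IsBddMeas P.m0 (P.attachFirst L t x y a b a' b') :=
  IsBddMeas.sum _ fun _ _ => IsBddMeas.sum _ fun _ _ => IsBddMeas.sum _ fun _ _ =>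
    bddMeas_ite_attachFirst L t x y a b a' b' _ _ _

lemma attachSecond_bddMeas (L : ℝ) (t x y a b a' b' : ℕ) :
    IsBddMeas P.m0 (P.attachSecond L t x y a b a' b') :=
  IsBddMeas.sum _ fun _ _ => IsBddMeas.sum _ fun _ _ => IsBddMeas.sum _ fun _ _ =>
    bddMeas_ite_attachSecond L t x y a b a' b' _ _ _

variable {x y a b a' b' : ℕ}

lemma integral_attachFirst_le (hp0 : 0 < p) (hp1 : p < 1) (hL : 0 ≤ L)
    (hy : y ∈ Finset.Icc 1 t) (ha : a ∈ Finset.Icc 1 t) (hb : b ∈ Finset.Icc 1 t)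
    (ha' : a' ∈ Finset.Icc 1 t) (hb' : b' ∈ Finset.Icc 1 t) :
    ∫ ω, P.attachFirst L t x y a b a' b' ω ∂P.μ ≤ attachRate p L x y *
      ((∑ s ∈ Finset.Ico 1 t, edgeRate p L a b s) *
        ∑ s ∈ Finset.Ico 1 t, edgeRate p L a' b' s) := by
  have hA := attachRate_nonneg (p := p) hL x y
  have hm := fun s₁ s₂ s₃ => bddMeas_ite_attachFirst (P := P) L t x y a b a' b' s₁ s₂ s₃
  unfold attachFirst
  rw [integral_finsetSum _ fun _ _ => (IsBddMeas.sum _ fun _ _ => IsBddMeas.sum _ fun _ _ =>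
    hm _ _ _).integrable]
  have hterm : ∀ s₁ ∈ Finset.Ico 1 t, ∀ s₂ ∈ Finset.Ico 1 t, ∀ s₃ ∈ Finset.Ico 1 t,
      ∫ ω, (if s₁ < s₂ ∧ s₂ < s₃ then P.goodAttach L t s₁ x y ω * P.goodEdge L t s₂ a b ω *
        P.goodEdge L t s₃ a' b' ω else 0) ∂P.μ ≤
      attachRate p L x y * (∫ ω, 1 * P.birthInd s₁ x ω ∂P.μ) *
        (edgeRate p L a b s₂ * edgeRate p L a' b' s₃) := by
    intro s₁ h₁ s₂ h₂ s₃ h₃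
    rw [Finset.mem_Ico] at h₁ h₂ h₃
    have r2 := edgeRate_nonneg p L a b s₂
    have r3 := edgeRate_nonneg p L a' b' s₃
    have hb0 : 0 ≤ ∫ ω, 1 * P.birthInd s₁ x ω ∂P.μ :=
      integral_nonneg fun ω => by simpa using (P.birthInd_bddMeas s₁ x).nonneg ω
    split_ifs with h
    · have hV := (P.goodAttach_bddMeas L t s₁ x y).mono (P.ℱ.mono (show s₁ + 1 ≤ s₂ by omega))
      have hVE := (hV.mono (P.ℱ.mono (show s₂ ≤ s₂ + 1 by omega))).mul
        (P.goodEdge_bddMeas L t s₂ a b)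
      have i3 := integral_mul_goodEdge_le hp0 hp1 hL h₃.1
        (hVE.mono (P.ℱ.mono (show s₂ + 1 ≤ s₃ by omega))) ha' hb'
      have i2 := integral_mul_goodEdge_le hp0 hp1 hL h₂.1 hV ha hb
      have i1 := integral_mul_goodAttach_le (P := P) (f := fun _ => 1) (x := x) hp0 hp1 hL h₁.1
        (IsBddMeas.const zero_le_one) hy
      simp only [one_mul] at i1 ⊢
      calc _ ≤ _ := i3
        _ ≤ edgeRate p L a' b' s₃ * (edgeRate p L a b s₂ * (attachRate p L x y *
            ∫ ω, P.birthInd s₁ x ω ∂P.μ)) := by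
          gcongr
          refine i2.trans ?_
          gcongr
        _ = _ := by ring
    · simp only [integral_zero]
      positivity
  have hbirth : ∑ s ∈ Finset.Ico 1 t, ∫ ω, 1 * P.birthInd s x ω ∂P.μ ≤ 1 := by
    refine (sum_integral_mul_birthInd_le (P := P) (f := fun _ => 1)
      (IsBddMeas.const zero_le_one) x t).trans ?_
    simp
  calc _ ≤ ∑ s₁ ∈ Finset.Ico 1 t, ∑ s₂ ∈ Finset.Ico 1 t, ∑ s₃ ∈ Finset.Ico 1 t,
        attachRate p L x y * (∫ ω, 1 * P.birthInd s₁ x ω ∂P.μ) *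
          (edgeRate p L a b s₂ * edgeRate p L a' b' s₃) := by
        refine Finset.sum_le_sum fun s₁ h₁ => ?_
        rw [integral_finsetSum _ fun _ _ => (IsBddMeas.sum _ fun _ _ => hm _ _ _).integrable]
        refine Finset.sum_le_sum fun s₂ h₂ => ?_
        rw [integral_finsetSum _ fun _ _ => (hm _ _ _).integrable]
        exact Finset.sum_le_sum fun s₃ h₃ => hterm s₁ h₁ s₂ h₂ s₃ h₃
    _ = (attachRate p L x y * ∑ s ∈ Finset.Ico 1 t, ∫ ω, 1 * P.birthInd s x ω ∂P.μ) *
        ((∑ s ∈ Finset.Ico 1 t, edgeRate p L a b s) *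
          ∑ s ∈ Finset.Ico 1 t, edgeRate p L a' b' s) := by
        simp only [← Finset.mul_sum, ← Finset.sum_mul]
    _ ≤ _ := by
        refine mul_le_mul_of_nonneg_right (mul_le_of_le_one_right hA hbirth) ?_
        exact mul_nonneg (Finset.sum_nonneg fun _ _ => edgeRate_nonneg _ _ _ _ _)
          (Finset.sum_nonneg fun _ _ => edgeRate_nonneg _ _ _ _ _)

lemma integral_attachSecond_le (hp0 : 0 < p) (hp1 : p < 1) (hL : 0 ≤ L)
    (hy : y ∈ Finset.Icc 1 t) (ha : a ∈ Finset.Icc 1 t) (hb : b ∈ Finset.Icc 1 t)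
    (ha' : a' ∈ Finset.Icc 1 t) (hb' : b' ∈ Finset.Icc 1 t) :
    ∫ ω, P.attachSecond L t x y a b a' b' ω ∂P.μ ≤ attachRate p L x y *
      ((∑ s ∈ Finset.Ico 1 t, edgeRate p L a b s) *
        ∑ s ∈ Finset.Ico 1 t, edgeRate p L a' b' s) := by
  have hA := attachRate_nonneg (p := p) hL x y
  have hm := fun s₁ s₂ s₃ => bddMeas_ite_attachSecond (P := P) L t x y a b a' b' s₁ s₂ s₃
  unfold attachSecond
  rw [integral_finsetSum _ fun _ _ => (IsBddMeas.sum _ fun _ _ => IsBddMeas.sum _ fun _ _ =>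
    hm _ _ _).integrable]
  have hterm : ∀ s₁ ∈ Finset.Ico 1 t, ∀ s₂ ∈ Finset.Ico 1 t, ∀ s₃ ∈ Finset.Ico 1 t,
      ∫ ω, (if s₂ < s₁ ∧ s₁ < s₃ then P.goodEdge L t s₂ a b ω * P.goodAttach L t s₁ x y ω *
        P.goodEdge L t s₃ a' b' ω else 0) ∂P.μ ≤
      attachRate p L x y * edgeRate p L a' b' s₃ *
        ∫ ω, P.goodEdge L t s₂ a b ω * P.birthInd s₁ x ω ∂P.μ := by
    intro s₁ h₁ s₂ h₂ s₃ h₃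
    rw [Finset.mem_Ico] at h₁ h₂ h₃
    have r3 := edgeRate_nonneg p L a' b' s₃
    have hb0 : 0 ≤ ∫ ω, P.goodEdge L t s₂ a b ω * P.birthInd s₁ x ω ∂P.μ :=
      integral_nonneg fun ω => mul_nonneg ((P.goodEdge_bddMeas L t s₂ a b).nonneg ω)
        ((P.birthInd_bddMeas s₁ x).nonneg ω)
    split_ifs with h
    · have hE := (P.goodEdge_bddMeas L t s₂ a b).mono (P.ℱ.mono (show s₂ + 1 ≤ s₁ by omega))
      have hEV := (hE.mono (P.ℱ.mono (show s₁ ≤ s₁ + 1 by omega))).mul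
        (P.goodAttach_bddMeas L t s₁ x y)
      have i3 := integral_mul_goodEdge_le hp0 hp1 hL h₃.1
        (hEV.mono (P.ℱ.mono (show s₁ + 1 ≤ s₃ by omega))) ha' hb'
      have i2 := integral_mul_goodAttach_le (x := x) hp0 hp1 hL h₁.1 hE hy
      calc _ ≤ _ := i3
        _ ≤ edgeRate p L a' b' s₃ * (attachRate p L x y *
            ∫ ω, P.goodEdge L t s₂ a b ω * P.birthInd s₁ x ω ∂P.μ) := by gcongr
        _ = _ := by ring
    · simp only [integral_zero]
      positivity
  have hbirth : ∀ s₂ ∈ Finset.Ico 1 t,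
      ∑ s ∈ Finset.Ico 1 t, ∫ ω, P.goodEdge L t s₂ a b ω * P.birthInd s x ω ∂P.μ ≤
        edgeRate p L a b s₂ := by
    intro s₂ h₂
    refine (sum_integral_mul_birthInd_le
      ((P.goodEdge_bddMeas L t s₂ a b).mono (P.ℱ.le _)) x t).trans ?_
    simpa using integral_mul_goodEdge_le (P := P) (f := fun _ => 1) hp0 hp1 hL
      (Finset.mem_Ico.1 h₂).1 (IsBddMeas.const zero_le_one) ha hb
  calc _ ≤ ∑ s₂ ∈ Finset.Ico 1 t, ∑ s₃ ∈ Finset.Ico 1 t, ∑ s₁ ∈ Finset.Ico 1 t,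
        attachRate p L x y * edgeRate p L a' b' s₃ *
          ∫ ω, P.goodEdge L t s₂ a b ω * P.birthInd s₁ x ω ∂P.μ := by
        refine Finset.sum_le_sum fun s₂ h₂ => ?_
        rw [integral_finsetSum _ fun _ _ => (IsBddMeas.sum _ fun _ _ => hm _ _ _).integrable]
        refine Finset.sum_le_sum fun s₃ h₃ => ?_
        rw [integral_finsetSum _ fun _ _ => (hm _ _ _).integrable]
        exact Finset.sum_le_sum fun s₁ h₁ => hterm s₁ h₁ s₂ h₂ s₃ h₃
    _ ≤ ∑ s₂ ∈ Finset.Ico 1 t, ∑ s₃ ∈ Finset.Ico 1 t,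
        attachRate p L x y * edgeRate p L a' b' s₃ * edgeRate p L a b s₂ := by
        refine Finset.sum_le_sum fun s₂ h₂ => Finset.sum_le_sum fun s₃ h₃ => ?_
        rw [← Finset.mul_sum]
        exact mul_le_mul_of_nonneg_left (hbirth s₂ h₂)
          (mul_nonneg hA (edgeRate_nonneg _ _ _ _ _))
    _ = _ := by
        rw [Finset.sum_mul_sum]
        simp only [Finset.mul_sum]
        exact Finset.sum_congr rfl fun _ _ => Finset.sum_congr rfl fun _ _ => by ring

end Triples

end PAProcess

namespace PAProcess

variable {p : ℝ} (P : PAProcess p)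

section Counting

attribute [local instance] PAProcess.m0 PAProcess.isProb

/-- Number of triples of good steps creating a triangle `x y z` in which `x` is attached to `y`
and the other two pairs are joined by edge-steps. -/
noncomputable def triangleSteps (L : ℝ) (t x y z : ℕ) (ω : P.Ω) : ℝ :=
  P.attachFirst L t x y y z x z ω + P.attachFirst L t x y x z y z ω +
    P.attachSecond L t x y y z x z ω

variable {P} {L : ℝ} {t x y z : ℕ} {ω : P.Ω}

lemma triangleSteps_bddMeas (L : ℝ) (t x y z : ℕ) : IsBddMeas P.m0 (P.triangleSteps L t x y z) :=
  ((attachFirst_bddMeas L t x y y z x z).add (attachFirst_bddMeas L t x y x z y z)).add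
    (attachSecond_bddMeas L t x y y z x z)

lemma integral_triangleSteps_le (hp0 : 0 < p) (hp1 : p < 1) (hL : 0 ≤ L)
    (hx : x ∈ Finset.Icc 1 t) (hy : y ∈ Finset.Icc 1 t) (hz : z ∈ Finset.Icc 1 t) :
    ∫ ω, P.triangleSteps L t x y z ω ∂P.μ ≤ 3 * (attachRate p L x y *
      ((∑ s ∈ Finset.Ico 1 t, edgeRate p L y z s) *
        ∑ s ∈ Finset.Ico 1 t, edgeRate p L x z s)) := by
  have h1 := (attachFirst_bddMeas (P := P) L t x y y z x z).integrable (μ := P.μ)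
  have h2 := (attachFirst_bddMeas (P := P) L t x y x z y z).integrable (μ := P.μ)
  have h3 := (attachSecond_bddMeas (P := P) L t x y y z x z).integrable (μ := P.μ)
  have h12 : Integrable (fun ω => P.attachFirst L t x y y z x z ω +
    P.attachFirst L t x y x z y z ω) P.μ := h1.add h2
  unfold triangleSteps
  rw [integral_add h12 h3, integral_add h1 h2]
  have b1 := integral_attachFirst_le (P := P) (x := x) hp0 hp1 hL hy hy hz hx hz
  have b2 := integral_attachFirst_le (P := P) (x := x) hp0 hp1 hL hy hx hz hy hz
  have b3 := integral_attachSecond_le (P := P) (x := x) hp0 hp1 hL hy hy hz hx hz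
  rw [mul_comm (∑ s ∈ Finset.Ico 1 t, edgeRate p L x z s)] at b2
  linarith

lemma one_le_goodEdge {s a b : ℕ} (hg : ω ∈ P.good L t s) (h : P.EdgeStepEdge (s + 1) a b ω) :
    1 ≤ P.goodEdge L t s a b ω := by
  obtain ⟨_, hZ, h⟩ := h
  have h1 := (P.eInd_bddMeas s a b).nonneg ω
  have h2 := (P.eInd_bddMeas s b a).nonneg ω
  rw [goodEdge, goodInd, Set.indicator_of_mem hg, one_mul]
  rcases h with h | h
  · have : P.eInd s a b ω = 1 := by simp [eInd, hZ, h]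
    linarith
  · have : P.eInd s b a ω = 1 := by simp [eInd, hZ, h]
    linarith

lemma exists_step_of_edgeJoined {a b : ℕ} (h : P.EdgeJoined t a b ω) :
    ∃ s ∈ Finset.Ico 1 t, P.EdgeStepEdge (s + 1) a b ω := by
  obtain ⟨s, hs, h⟩ := h
  rw [Finset.mem_Icc] at hs
  have h2 := h.1
  refine ⟨s - 1, Finset.mem_Ico.2 (by omega), ?_⟩
  rwa [Nat.sub_add_cancel hs.1]

lemma edgeJoined_symm {a b : ℕ} (h : P.EdgeJoined t a b ω) : P.EdgeJoined t b a ω := by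
  obtain ⟨s, hs, h1, h2, h3⟩ := h
  exact ⟨s, hs, h1, h2, h3.symm⟩

lemma exists_step_of_vJoined (hxy : y < x) (h : P.VJoined t y x ω) :
    ∃ s ∈ Finset.Ico 1 t, P.Z (s + 1) ω = true ∧ P.ep (s + 1) ω = (y, x) ∧
      P.nv s ω + 1 = x := by
  obtain ⟨s, hs, h2, hZ, h⟩ := h
  rw [Finset.mem_Icc] at hs
  obtain ⟨n, rfl⟩ : ∃ n, s = n + 1 := ⟨s - 1, by omega⟩
  obtain ⟨h3, h4, h5⟩ := P.ep_vertexStep n (by omega) ω hZ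
  refine ⟨n, Finset.mem_Ico.2 (by omega), hZ, ?_⟩
  rcases h with h | h
  · rw [h] at h3
    exact ⟨h, h3.symm⟩
  · rw [h] at h3 h5
    simp only at h3 h5
    omega

lemma one_le_sum_sum_sum {S : Finset ℕ} {F : ℕ → ℕ → ℕ → ℝ} (hF : ∀ a b c, 0 ≤ F a b c)
    {a b c : ℕ} (ha : a ∈ S) (hb : b ∈ S) (hc : c ∈ S) (h : 1 ≤ F a b c) :
    1 ≤ ∑ a ∈ S, ∑ b ∈ S, ∑ c ∈ S, F a b c := by
  refine h.trans ?_
  calc F a b c ≤ ∑ c ∈ S, F a b c := Finset.single_le_sum (fun c _ => hF a b c) hc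
    _ ≤ ∑ b ∈ S, ∑ c ∈ S, F a b c := Finset.single_le_sum
        (f := fun b => ∑ c ∈ S, F a b c) (fun b _ => Finset.sum_nonneg fun c _ => hF a b c) hb
    _ ≤ _ := Finset.single_le_sum (f := fun a => ∑ b ∈ S, ∑ c ∈ S, F a b c)
        (fun a _ => Finset.sum_nonneg fun b _ => Finset.sum_nonneg fun c _ => hF a b c) ha

lemma one_le_triangleSteps (hg : ∀ s ∈ Finset.Ico 1 t, ω ∈ P.good L t s) (hxy : y < x)
    (h₁ : P.VJoined t y x ω) (h₂ : P.EdgeJoined t y z ω) (h₃ : P.EdgeJoined t x z ω) :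
    1 ≤ P.triangleSteps L t x y z ω := by
  obtain ⟨s₁, hs₁, hZ₁, he₁, hn₁⟩ := exists_step_of_vJoined hxy h₁
  obtain ⟨s₂, hs₂, h₂⟩ := exists_step_of_edgeJoined h₂
  obtain ⟨s₃, hs₃, h₃⟩ := exists_step_of_edgeJoined h₃
  have e₂ := one_le_goodEdge (hg s₂ hs₂) h₂
  have e₃ := one_le_goodEdge (hg s₃ hs₃) h₃
  have e₁ : P.goodAttach L t s₁ x y ω = 1 := by
    rw [goodAttach, goodInd, Set.indicator_of_mem (hg s₁ hs₁)]
    simp [vInd, hZ₁, he₁, hn₁]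
  obtain ⟨_, hZ₂, h₂⟩ := h₂
  obtain ⟨_, hZ₃, h₃⟩ := h₃
  have h13 : s₁ < s₃ := by
    by_contra! hle
    have hle' := P.nv_mono (Finset.mem_Ico.1 hs₃).1 hle ω
    have hb := P.ep_edgeStep s₃ (Finset.mem_Ico.1 hs₃).1 ω hZ₃
    rcases h₃ with h | h <;> rw [h] at hb <;> simp only at hb <;> omega
  have h12 : s₁ ≠ s₂ := by
    rintro rfl
    rw [hZ₁] at hZ₂
    cases hZ₂
  have h23 : s₂ ≠ s₃ := by
    rintro rfl
    rcases h₂ with h | h <;> rcases h₃ with h' | h' <;> rw [h] at h' <;>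
      simp only [Prod.mk.injEq] at h' <;> omega
  have n1 := (attachFirst_bddMeas (P := P) L t x y y z x z).nonneg ω
  have n2 := (attachFirst_bddMeas (P := P) L t x y x z y z).nonneg ω
  have n3 := (attachSecond_bddMeas (P := P) L t x y y z x z).nonneg ω
  have hprod : 1 ≤ P.goodEdge L t s₂ y z ω * P.goodEdge L t s₃ x z ω := by nlinarith
  unfold triangleSteps
  rcases lt_or_gt_of_ne h12 with h12 | h12
  · rcases lt_or_gt_of_ne h23 with h23 | h23
    · have : 1 ≤ P.attachFirst L t x y y z x z ω := by
        refine one_le_sum_sum_sum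
          (fun a b c => (bddMeas_ite_attachFirst L t x y y z x z a b c).nonneg ω) hs₁ hs₂ hs₃ ?_
        rw [if_pos ⟨h12, h23⟩, e₁]
        linarith
      linarith
    · have : 1 ≤ P.attachFirst L t x y x z y z ω := by
        refine one_le_sum_sum_sum
          (fun a b c => (bddMeas_ite_attachFirst L t x y x z y z a b c).nonneg ω) hs₁ hs₃ hs₂ ?_
        rw [if_pos ⟨h13, h23⟩, e₁]
        linarith
      linarith
  · have : 1 ≤ P.attachSecond L t x y y z x z ω := by
      refine one_le_sum_sum_sum
        (fun a b c => (bddMeas_ite_attachSecond L t x y y z x z c a b).nonneg ω) hs₂ hs₃ hs₁ ?_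
      rw [if_pos ⟨h12, h13⟩, e₁]
      linarith
    linarith

variable (P) in
/-- A function dominating the indicator that some degree exceeds its typical size. -/
noncomputable def badBound (L : ℝ) (t : ℕ) (ω : P.Ω) : ℝ :=
  ∑ s ∈ Finset.Ico 1 t, ∑ i ∈ Finset.Ico 1 s,
    Real.exp (-(L / 2)) * (1 - tailParam p i s)⁻¹ ^ max (P.deg s i ω) 1

lemma bddMeas_badBound_term (hp1 : p < 1) {i s : ℕ} (h : i + 1 ≤ s) :
    IsBddMeas P.m0 (fun ω =>
      Real.exp (-(L / 2)) * (1 - tailParam p i s)⁻¹ ^ max (P.deg s i ω) 1) :=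
  (IsBddMeas.const (Real.exp_pos _).le).mul
    ((pow_max_deg_bddMeas s i (one_le_inv_tailParam hp1 h)).mono (P.ℱ.le _))

lemma badBound_bddMeas (hp1 : p < 1) : IsBddMeas P.m0 (P.badBound L t) :=
  IsBddMeas.sum _ fun _ _ => IsBddMeas.sum _ fun _ hi =>
    bddMeas_badBound_term hp1 (Finset.mem_Ico.1 hi).2

lemma integral_badBound_le (hp0 : 0 < p) (hp1 : p < 1) :
    ∫ ω, P.badBound L t ω ∂P.μ ≤ (t : ℝ) ^ 2 * (Real.exp (-(L / 2)) * 16) := by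
  unfold badBound
  rw [integral_finsetSum _ fun s _ => (IsBddMeas.sum _ fun i hi =>
    bddMeas_badBound_term hp1 (Finset.mem_Ico.1 hi).2).integrable]
  have h : ∀ s ∈ Finset.Ico 1 t, ∫ ω, ∑ i ∈ Finset.Ico 1 s,
      Real.exp (-(L / 2)) * (1 - tailParam p i s)⁻¹ ^ max (P.deg s i ω) 1 ∂P.μ ≤
        (t : ℝ) * (Real.exp (-(L / 2)) * 16) := by
    intro s hs
    rw [integral_finsetSum _ fun i hi =>
      (bddMeas_badBound_term hp1 (Finset.mem_Ico.1 hi).2).integrable]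
    have hst : ((s - 1 : ℕ) : ℝ) ≤ t := by
      have := (Finset.mem_Ico.1 hs).2
      exact_mod_cast (by omega : s - 1 ≤ t)
    refine (Finset.sum_le_card_nsmul _ _ (Real.exp (-(L / 2)) * 16) fun i hi => ?_).trans ?_
    · rw [integral_const_mul]
      have hi := Finset.mem_Ico.1 hi
      gcongr
      exact integral_tail_pow_le hp0 hp1 hi.1 hi.2
    · rw [Nat.card_Ico, nsmul_eq_mul]
      gcongr
  refine (Finset.sum_le_card_nsmul _ _ _ h).trans ?_
  rw [Nat.card_Ico, nsmul_eq_mul, pow_two, mul_assoc]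
  have : ((t - 1 : ℕ) : ℝ) ≤ t := by exact_mod_cast Nat.sub_le t 1
  gcongr

lemma one_le_badBound (hp1 : p < 1) (hL : 2 ≤ L) {s : ℕ} (hs : s ∈ Finset.Ico 1 t)
    (hg : ω ∉ P.good L t s) : 1 ≤ P.badBound L t ω := by
  have hg' : ¬ ∀ i ∈ Finset.Icc 1 t,
      (P.deg s i ω : ℝ) ≤ L * ((s : ℝ) / i) ^ (1 - p / 2) := hg
  push Not at hg'
  obtain ⟨i, hi, hd⟩ := hg'
  have hi1 := (Finset.mem_Icc.1 hi).1
  have his : i < s := by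
    by_contra! hle
    rcases hle.lt_or_eq with h | rfl
    · rw [P.deg_eq_zero_of_lt ω h] at hd
      have : (0 : ℝ) ≤ L * ((s : ℝ) / i) ^ (1 - p / 2) := by positivity
      simp only [Nat.cast_zero] at hd
      linarith
    · have h0 : (s : ℝ) ≠ 0 := by positivity
      rw [div_self h0, Real.one_rpow, mul_one] at hd
      have : (P.deg s s ω : ℝ) ≤ 2 := by exact_mod_cast P.deg_self_le hi1 ω
      linarith
  have hn : ∀ s, ∀ i ∈ Finset.Ico 1 s,
      0 ≤ Real.exp (-(L / 2)) * (1 - tailParam p i s)⁻¹ ^ max (P.deg s i ω) 1 :=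
    fun s i hi => (bddMeas_badBound_term (P := P) (L := L) hp1 (Finset.mem_Ico.1 hi).2).nonneg ω
  refine (one_le_exp_mul_tail_pow hp1 hi1 his (by linarith) hd).trans ?_
  refine (Finset.single_le_sum (hn s) (Finset.mem_Ico.2 ⟨hi1, his⟩)).trans ?_
  exact Finset.single_le_sum (f := fun s => ∑ i ∈ Finset.Ico 1 s,
    Real.exp (-(L / 2)) * (1 - tailParam p i s)⁻¹ ^ max (P.deg s i ω) 1)
    (fun s _ => Finset.sum_nonneg (hn s)) hs

lemma sum_edgeRate_le (hp0 : 0 < p) (hp1 : p < 1) (L : ℝ) (a b t : ℕ) :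
    ∑ s ∈ Finset.Ico 1 t, edgeRate p L a b s ≤
      L ^ 2 / 2 / ((a : ℝ) ^ (1 - p / 2) * (b : ℝ) ^ (1 - p / 2)) *
        ((t : ℝ) ^ (1 - p) / (1 - p)) := by
  have h : ∀ s ∈ Finset.Ico 1 t, edgeRate p L a b s =
      L ^ 2 / 2 / ((a : ℝ) ^ (1 - p / 2) * (b : ℝ) ^ (1 - p / 2)) * (s : ℝ) ^ (-p) := by
    intro s hs
    have hs' : (0 : ℝ) < s := by exact_mod_cast (Finset.mem_Ico.1 hs).1
    have e : (s : ℝ) ^ (1 - p / 2) * (s : ℝ) ^ (1 - p / 2) = s ^ 2 * (s : ℝ) ^ (-p) := by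
      rw [← Real.rpow_add hs', ← Real.rpow_natCast, ← Real.rpow_add hs']
      congr 1
      push_cast
      ring
    rw [edgeRate, Real.div_rpow hs'.le (by positivity), Real.div_rpow hs'.le (by positivity),
      div_mul_div_comm ((s : ℝ) ^ (1 - p / 2)), e]
    field_simp
  rw [Finset.sum_congr rfl h, ← Finset.mul_sum]
  refine mul_le_mul_of_nonneg_left ?_ (by positivity)
  refine le_trans ?_ (sum_rpow_neg_le hp0 hp1 t)
  exact Finset.sum_le_sum_of_subset_of_nonneg Finset.Ico_subset_Icc_self
    fun _ _ _ => by positivity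

lemma rate_prod_le (hp0 : 0 < p) (hp1 : p < 1) (hL : 0 ≤ L) {M : ℝ} (hM : 0 < M)
    (hx : 1 ≤ x) (hy : 1 ≤ y) (hz : 1 ≤ z) (h : M ≤ (x : ℝ) * y * z) :
    attachRate p L x y * ((∑ s ∈ Finset.Ico 1 t, edgeRate p L y z s) *
        ∑ s ∈ Finset.Ico 1 t, edgeRate p L x z s) ≤
      L ^ 5 / 4 * ((t : ℝ) ^ (1 - p) / (1 - p)) ^ 2 * M ^ (-(1 - p)) *
        ((x : ℝ) ^ (-p) * (y : ℝ)⁻¹ * (z : ℝ)⁻¹) := by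
  have hx' : (0 : ℝ) < x := by exact_mod_cast hx
  have hy' : (0 : ℝ) < y := by exact_mod_cast hy
  have hz' : (0 : ℝ) < z := by exact_mod_cast hz
  have hq : 0 < 1 - p := by linarith
  set T := (t : ℝ) ^ (1 - p) / (1 - p) with hT
  have hT0 : 0 ≤ T := by positivity
  have hA := attachRate_nonneg (p := p) hL x y
  have sq : ∀ v : ℝ, 0 < v → v ^ (1 - p / 2) * v ^ (1 - p / 2) = v * v ^ (1 - p) := by
    intro v hv
    rw [← Real.rpow_add hv, ← Real.rpow_one_add' hv.le (by linarith)]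
    congr 1
    ring
  have hxe : (x : ℝ) ^ (-(p / 2)) / (x : ℝ) ^ (1 - p / 2) =
      (x : ℝ) ^ (-p) * ((x : ℝ) ^ (1 - p))⁻¹ := by
    rw [← Real.rpow_sub hx', ← Real.rpow_neg hx'.le, ← Real.rpow_add hx']
    congr 1
    ring
  have hMle : ((x : ℝ) * y * z) ^ (-(1 - p)) ≤ M ^ (-(1 - p)) :=
    Real.rpow_le_rpow_of_nonpos hM h (by linarith)
  calc _ ≤ attachRate p L x y *
        ((L ^ 2 / 2 / ((y : ℝ) ^ (1 - p / 2) * (z : ℝ) ^ (1 - p / 2)) * T) *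
          (L ^ 2 / 2 / ((x : ℝ) ^ (1 - p / 2) * (z : ℝ) ^ (1 - p / 2)) * T)) := by
        refine mul_le_mul_of_nonneg_left (mul_le_mul (sum_edgeRate_le hp0 hp1 L y z t)
          (sum_edgeRate_le hp0 hp1 L x z t)
          (Finset.sum_nonneg fun _ _ => edgeRate_nonneg _ _ _ _ _) (by positivity)) hA
    _ = L ^ 5 / 4 * T ^ 2 * ((x : ℝ) ^ (-(p / 2)) / (x : ℝ) ^ (1 - p / 2)) *
        ((y : ℝ) ^ (1 - p / 2) * (y : ℝ) ^ (1 - p / 2))⁻¹ *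
        ((z : ℝ) ^ (1 - p / 2) * (z : ℝ) ^ (1 - p / 2))⁻¹ := by
        unfold attachRate
        field_simp
        ring
    _ = L ^ 5 / 4 * T ^ 2 * ((x : ℝ) * y * z) ^ (-(1 - p)) *
        ((x : ℝ) ^ (-p) * (y : ℝ)⁻¹ * (z : ℝ)⁻¹) := by
        rw [sq _ hy', sq _ hz', hxe, Real.rpow_neg (x := (x : ℝ) * y * z) (by positivity),
          Real.mul_rpow (by positivity) hz'.le, Real.mul_rpow hx'.le hy'.le]
        simp only [mul_inv]
        ring
    _ ≤ _ := by gcongr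

end Counting

end PAProcess

namespace PAProcess

variable {p : ℝ} (P : PAProcess p)

section Expectation

attribute [local instance] PAProcess.m0 PAProcess.isProb

/-- The triples of vertex labels whose product is at least `M`. -/
noncomputable def largeTriples (M : ℝ) (t : ℕ) : Finset (ℕ × ℕ × ℕ) :=
  (Finset.Icc 1 t ×ˢ Finset.Icc 1 t ×ˢ Finset.Icc 1 t).filter
    (fun q => M ≤ ((q.1 * q.2.1 * q.2.2 : ℕ) : ℝ))

/-- The triangles counted by `𝒯₂¹(G_t)`, with `M` in place of `t ^ (3 * α)`. -/
noncomputable def mixedTriangles (M : ℝ) (t : ℕ) (ω : P.Ω) : Finset (ℕ × ℕ × ℕ) :=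
  (Finset.Icc 1 t ×ˢ Finset.Icc 1 t ×ˢ Finset.Icc 1 t).filter
    (fun q => q.1 < q.2.1 ∧ q.2.1 < q.2.2 ∧
      M ≤ ((q.1 * q.2.1 * q.2.2 : ℕ) : ℝ) ∧
      ((P.VJoined t q.1 q.2.1 ω ∧ P.EdgeJoined t q.1 q.2.2 ω ∧
          P.EdgeJoined t q.2.1 q.2.2 ω) ∨
       (P.EdgeJoined t q.1 q.2.1 ω ∧ P.VJoined t q.1 q.2.2 ω ∧
          P.EdgeJoined t q.2.1 q.2.2 ω) ∨
       (P.EdgeJoined t q.1 q.2.1 ω ∧ P.EdgeJoined t q.1 q.2.2 ω ∧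
          P.VJoined t q.2.1 q.2.2 ω)))

/-- Number of triples of good steps creating a triangle on the labels `q`. -/
noncomputable def tripleSteps (L : ℝ) (t : ℕ) (q : ℕ × ℕ × ℕ) (ω : P.Ω) : ℝ :=
  P.triangleSteps L t q.2.1 q.1 q.2.2 ω + P.triangleSteps L t q.2.2 q.1 q.2.1 ω +
    P.triangleSteps L t q.2.2 q.2.1 q.1 ω

variable {P} {L : ℝ} {t : ℕ}

lemma tripleSteps_bddMeas (L : ℝ) (t : ℕ) (q : ℕ × ℕ × ℕ) :
    IsBddMeas P.m0 (P.tripleSteps L t q) :=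
  ((triangleSteps_bddMeas L t _ _ _).add (triangleSteps_bddMeas L t _ _ _)).add
    (triangleSteps_bddMeas L t _ _ _)

lemma card_mixedTriangles_le (hp1 : p < 1) (hL : 2 ≤ L) (M : ℝ) (ω : P.Ω) :
    ((P.mixedTriangles M t ω).card : ℝ) ≤
      (t : ℝ) ^ 3 * P.badBound L t ω + ∑ q ∈ largeTriples M t, P.tripleSteps L t q ω := by
  have hb := (badBound_bddMeas (P := P) (L := L) (t := t) hp1).nonneg ω
  have hn : ∀ q, 0 ≤ P.tripleSteps L t q ω := fun q => (tripleSteps_bddMeas L t q).nonneg ω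
  by_cases hg : ∀ s ∈ Finset.Ico 1 t, ω ∈ P.good L t s
  · have hsub : P.mixedTriangles M t ω ⊆ largeTriples M t := by
      intro q hq
      simp only [mixedTriangles, largeTriples, Finset.mem_filter] at hq ⊢
      exact ⟨hq.1, hq.2.2.2.1⟩
    have h1 : ((P.mixedTriangles M t ω).card : ℝ) ≤
        ∑ q ∈ P.mixedTriangles M t ω, P.tripleSteps L t q ω := by
      rw [Finset.card_eq_sum_ones, Nat.cast_sum, Nat.cast_one]
      refine Finset.sum_le_sum fun q hq => ?_
      have n1 := (triangleSteps_bddMeas (P := P) L t q.2.1 q.1 q.2.2).nonneg ω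
      have n2 := (triangleSteps_bddMeas (P := P) L t q.2.2 q.1 q.2.1).nonneg ω
      have n3 := (triangleSteps_bddMeas (P := P) L t q.2.2 q.2.1 q.1).nonneg ω
      unfold tripleSteps
      obtain ⟨_, hij, hjk, _, h⟩ := Finset.mem_filter.1 hq
      rcases h with ⟨h1, h2, h3⟩ | ⟨h1, h2, h3⟩ | ⟨h1, h2, h3⟩
      · linarith [one_le_triangleSteps hg hij h1 h2 h3]
      · linarith [one_le_triangleSteps hg (hij.trans hjk) h2 h1 (edgeJoined_symm h3)]
      · linarith [one_le_triangleSteps hg hjk h3 (edgeJoined_symm h1) (edgeJoined_symm h2)]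
    have h2 := Finset.sum_le_sum_of_subset_of_nonneg hsub fun q _ _ => hn q
    have h3 : 0 ≤ (t : ℝ) ^ 3 * P.badBound L t ω := by positivity
    linarith
  · push Not at hg
    obtain ⟨s, hs, hg⟩ := hg
    have h1 := one_le_badBound hp1 hL hs hg
    have h2 : ((P.mixedTriangles M t ω).card : ℝ) ≤ (t : ℝ) ^ 3 := by
      have hc : (P.mixedTriangles M t ω).card ≤ t ^ 3 := by
        refine (Finset.card_filter_le _ _).trans ?_
        simp only [Finset.card_product, Nat.card_Icc, Nat.add_sub_cancel]
        exact le_of_eq (by ring)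
      exact_mod_cast hc
    have h3 : (t : ℝ) ^ 3 * 1 ≤ (t : ℝ) ^ 3 * P.badBound L t ω := by gcongr
    have h4 : 0 ≤ ∑ q ∈ largeTriples M t, P.tripleSteps L t q ω :=
      Finset.sum_nonneg fun q _ => hn q
    linarith

lemma integral_tripleSteps_le (hp0 : 0 < p) (hp1 : p < 1) (hL : 0 ≤ L) {M : ℝ} (hM : 0 < M)
    {q : ℕ × ℕ × ℕ} (hq : q ∈ largeTriples M t) :
    ∫ ω, P.tripleSteps L t q ω ∂P.μ ≤
      3 * (L ^ 5 / 4 * ((t : ℝ) ^ (1 - p) / (1 - p)) ^ 2 * M ^ (-(1 - p))) *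
        ((q.1 : ℝ)⁻¹ * ((q.2.1 : ℝ) ^ (-p) * (q.2.2 : ℝ)⁻¹) +
          2 * ((q.1 : ℝ)⁻¹ * ((q.2.1 : ℝ)⁻¹ * (q.2.2 : ℝ) ^ (-p)))) := by
  obtain ⟨hq, h⟩ := Finset.mem_filter.1 hq
  obtain ⟨hi, hjk⟩ := Finset.mem_product.1 hq
  obtain ⟨hj, hk⟩ := Finset.mem_product.1 hjk
  push_cast at h
  have hi1 := (Finset.mem_Icc.1 hi).1
  have hj1 := (Finset.mem_Icc.1 hj).1
  have hk1 := (Finset.mem_Icc.1 hk).1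
  have m := fun x y z =>
    (triangleSteps_bddMeas (P := P) L t x y z).integrable (μ := P.μ)
  have m12 : Integrable (fun ω => P.triangleSteps L t q.2.1 q.1 q.2.2 ω +
    P.triangleSteps L t q.2.2 q.1 q.2.1 ω) P.μ := (m _ _ _).add (m _ _ _)
  unfold tripleSteps
  rw [integral_add m12 (m _ _ _), integral_add (m _ _ _) (m _ _ _)]
  have b1 := integral_triangleSteps_le (P := P) hp0 hp1 hL hj hi hk
  have b2 := integral_triangleSteps_le (P := P) hp0 hp1 hL hk hi hj
  have b3 := integral_triangleSteps_le (P := P) hp0 hp1 hL hk hj hi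
  have r1 := rate_prod_le (t := t) hp0 hp1 hL hM hj1 hi1 hk1 (h.trans_eq (by ring))
  have r2 := rate_prod_le (t := t) hp0 hp1 hL hM hk1 hi1 hj1 (h.trans_eq (by ring))
  have r3 := rate_prod_le (t := t) hp0 hp1 hL hM hk1 hj1 hi1 (h.trans_eq (by ring))
  linarith

lemma sum_cube_mul (s : Finset ℕ) (f g h : ℕ → ℝ) :
    ∑ q ∈ s ×ˢ s ×ˢ s, f q.1 * (g q.2.1 * h q.2.2) =
      (∑ i ∈ s, f i) * ((∑ i ∈ s, g i) * ∑ i ∈ s, h i) := by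
  rw [Finset.sum_product, Finset.sum_mul]
  refine Finset.sum_congr rfl fun i _ => ?_
  rw [Finset.sum_product, Finset.sum_mul_sum, Finset.mul_sum]
  exact Finset.sum_congr rfl fun j _ => by rw [Finset.mul_sum]

lemma sum_integral_tripleSteps_le (hp0 : 0 < p) (hp1 : p < 1) (hL : 0 ≤ L) {M : ℝ} (hM : 0 < M)
    (ht : 2 ≤ t) :
    ∑ q ∈ largeTriples M t, ∫ ω, P.tripleSteps L t q ω ∂P.μ ≤
      81 / 4 * L ^ 5 * ((t : ℝ) ^ (1 - p) / (1 - p)) ^ 3 * M ^ (-(1 - p)) *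
        Real.log t ^ 2 := by
  have hq : 0 < 1 - p := by linarith
  set T := (t : ℝ) ^ (1 - p) / (1 - p) with hT
  have hT0 : 0 ≤ T := by positivity
  have h1 := sum_rpow_neg_le hp0 hp1 t
  have h2 := sum_inv_le_log ht
  rw [← hT] at h1
  set A := ∑ s ∈ Finset.Icc 1 t, (s : ℝ) ^ (-p)
  set H := ∑ s ∈ Finset.Icc 1 t, (s : ℝ)⁻¹ with hH
  have hH0 : 0 ≤ H := Finset.sum_nonneg fun _ _ => by positivity
  have hlog : 0 ≤ Real.log t := Real.log_natCast_nonneg t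
  calc _ ≤ _ := Finset.sum_le_sum fun q hq => integral_tripleSteps_le hp0 hp1 hL hM hq
    _ ≤ ∑ q ∈ Finset.Icc 1 t ×ˢ Finset.Icc 1 t ×ˢ Finset.Icc 1 t,
        3 * (L ^ 5 / 4 * T ^ 2 * M ^ (-(1 - p))) *
        ((q.1 : ℝ)⁻¹ * ((q.2.1 : ℝ) ^ (-p) * (q.2.2 : ℝ)⁻¹) +
          2 * ((q.1 : ℝ)⁻¹ * ((q.2.1 : ℝ)⁻¹ * (q.2.2 : ℝ) ^ (-p)))) :=
        Finset.sum_le_sum_of_subset_of_nonneg (Finset.filter_subset _ _)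
          fun _ _ _ => by positivity
    _ = 9 * (L ^ 5 / 4 * T ^ 2 * M ^ (-(1 - p))) * (A * H ^ 2) := by
        rw [← Finset.mul_sum, Finset.sum_add_distrib, ← Finset.mul_sum,
          sum_cube_mul _ (fun i => (i : ℝ)⁻¹) (fun i => (i : ℝ) ^ (-p)) (fun i => (i : ℝ)⁻¹),
          sum_cube_mul _ (fun i => (i : ℝ)⁻¹) (fun i => (i : ℝ)⁻¹) (fun i => (i : ℝ) ^ (-p))]
        ring
    _ ≤ 9 * (L ^ 5 / 4 * T ^ 2 * M ^ (-(1 - p))) * (T * (3 * Real.log t) ^ 2) := by gcongr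
    _ = _ := by ring

lemma rpow_mul_rpow_exponent (hp1 : p < 1) {t : ℝ} (ht : 0 < t) :
    (t ^ (1 - p)) ^ 3 * (t ^ (3 * ((1 - p) / (2 - p)))) ^ (-(1 - p)) =
      t ^ (3 * ((1 - p) / (2 - p))) := by
  have h2 : 2 - p ≠ 0 := by linarith
  rw [← Real.rpow_natCast, ← Real.rpow_mul ht.le, ← Real.rpow_mul ht.le, ← Real.rpow_add ht]
  congr 1
  push_cast
  field_simp
  ring

lemma integral_card_mixedTriangles_le (P : PAProcess p) (hp0 : 0 < p) (hp1 : p < 1)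
    (ht : 2 ≤ t) :
    ∫ ω, ((P.mixedTriangles ((t : ℝ) ^ (3 * ((1 - p) / (2 - p)))) t ω).card : ℝ) ∂P.μ ≤
      (16 / Real.log 2 ^ 7 + 81 / 4 * 10 ^ 5 / (1 - p) ^ 3) *
        (t : ℝ) ^ (3 * ((1 - p) / (2 - p))) * Real.log t ^ 7 := by
  have hq : 0 < 1 - p := by linarith
  have hq2 : 0 < 2 - p := by linarith
  have ht1 : (1 : ℝ) ≤ t := by exact_mod_cast (by omega : 1 ≤ t)
  have ht0 : (0 : ℝ) < t := by linarith
  set M := (t : ℝ) ^ (3 * ((1 - p) / (2 - p))) with hM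
  have hM0 : 0 < M := by positivity
  have hM1 : 1 ≤ M := Real.one_le_rpow ht1 (by positivity)
  have hl2 : 0 < Real.log 2 := Real.log_pos (by norm_num)
  have hl : Real.log 2 ≤ Real.log t := Real.log_le_log (by norm_num) (by exact_mod_cast ht)
  set L := 10 * Real.log t with hLdef
  have hL : 2 ≤ L := by linarith [Real.log_two_gt_d9]
  have hi1 := (badBound_bddMeas (P := P) (L := L) (t := t) hp1).integrable (μ := P.μ)
  have hi2 : ∀ q ∈ largeTriples M t, Integrable (P.tripleSteps L t q) P.μ :=
    fun q _ => (tripleSteps_bddMeas L t q).integrable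
  have hi3 := integrable_finsetSum _ hi2
  have hbad : (t : ℝ) ^ 3 * ((t : ℝ) ^ 2 * (Real.exp (-(L / 2)) * 16)) = 16 := by
    have : Real.exp (-(L / 2)) = ((t : ℝ) ^ 5)⁻¹ := by
      rw [← Real.exp_log (show 0 < (t : ℝ) ^ 5 by positivity), ← Real.exp_neg, Real.log_pow]
      congr 1
      push_cast
      ring
    rw [this]
    field_simp
  calc _ ≤ ∫ ω, ((t : ℝ) ^ 3 * P.badBound L t ω +
        ∑ q ∈ largeTriples M t, P.tripleSteps L t q ω) ∂P.μ :=
        integral_mono_of_nonneg (ae_of_all _ fun _ => Nat.cast_nonneg _)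
          ((hi1.const_mul _).add hi3) (ae_of_all _ fun ω => card_mixedTriangles_le hp1 hL M ω)
    _ = (t : ℝ) ^ 3 * ∫ ω, P.badBound L t ω ∂P.μ +
        ∑ q ∈ largeTriples M t, ∫ ω, P.tripleSteps L t q ω ∂P.μ := by
        rw [integral_add (hi1.const_mul _) hi3, integral_const_mul, integral_finsetSum _ hi2]
    _ ≤ (t : ℝ) ^ 3 * ((t : ℝ) ^ 2 * (Real.exp (-(L / 2)) * 16)) +
        81 / 4 * L ^ 5 * ((t : ℝ) ^ (1 - p) / (1 - p)) ^ 3 * M ^ (-(1 - p)) *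
          Real.log t ^ 2 := by
        gcongr
        · exact integral_badBound_le hp0 hp1
        · exact sum_integral_tripleSteps_le hp0 hp1 (by linarith) hM0 ht
    _ = 16 + 81 / 4 * 10 ^ 5 / (1 - p) ^ 3 *
        (((t : ℝ) ^ (1 - p)) ^ 3 * M ^ (-(1 - p))) * Real.log t ^ 7 := by
        rw [hbad, hLdef]
        field_simp
    _ = 16 / Real.log 2 ^ 7 * 1 * Real.log 2 ^ 7 +
        81 / 4 * 10 ^ 5 / (1 - p) ^ 3 * M * Real.log t ^ 7 := by
        rw [hM, rpow_mul_rpow_exponent hp1 ht0]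
        field_simp
    _ ≤ 16 / Real.log 2 ^ 7 * M * Real.log t ^ 7 +
        81 / 4 * 10 ^ 5 / (1 - p) ^ 3 * M * Real.log t ^ 7 := by gcongr
    _ = _ := by ring

end Expectation

end PAProcess

/-- For `p ∈ (0,1)` and `α = (1-p)/(2-p)`, let `𝒯₂¹(G_t)` be the number of triples
`i < j < k` with `i·j·k ≥ t^{3α}` forming a triangle in `G_t` in which two of the three
pairs are joined by edges created at edge-steps and the remaining pair is joined by an edge
created at a vertex-step.  Then there is `C > 0` (depending only on `p`) such that
`E[𝒯₂¹(G_t)] ≤ C t^{3α} (log t)⁷` for all `t ≥ 2`. -/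
theorem expected_T21_bound (p : ℝ) (hp0 : 0 < p) (hp1 : p < 1)
    (P : PAProcess p) :
    ∃ C : ℝ, 0 < C ∧
      ∀ t : ℕ, 2 ≤ t →
        ∫ ω, ((((Finset.Icc 1 t ×ˢ Finset.Icc 1 t ×ˢ Finset.Icc 1 t).filter
            (fun q => q.1 < q.2.1 ∧ q.2.1 < q.2.2 ∧
              (t : ℝ) ^ (3 * ((1 - p) / (2 - p))) ≤ ((q.1 * q.2.1 * q.2.2 : ℕ) : ℝ) ∧
              ((P.VJoined t q.1 q.2.1 ω ∧ P.EdgeJoined t q.1 q.2.2 ω ∧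
                  P.EdgeJoined t q.2.1 q.2.2 ω) ∨
               (P.EdgeJoined t q.1 q.2.1 ω ∧ P.VJoined t q.1 q.2.2 ω ∧
                  P.EdgeJoined t q.2.1 q.2.2 ω) ∨
               (P.EdgeJoined t q.1 q.2.1 ω ∧ P.EdgeJoined t q.1 q.2.2 ω ∧
                  P.VJoined t q.2.1 q.2.2 ω)))).card : ℕ) : ℝ) ∂P.μ ≤
          C * (t : ℝ) ^ (3 * ((1 - p) / (2 - p))) * Real.log t ^ 7 := by
  have hq : 0 < 1 - p := by linarith
  have hl : 0 < Real.log 2 := Real.log_pos (by norm_num)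
  exact ⟨16 / Real.log 2 ^ 7 + 81 / 4 * 10 ^ 5 / (1 - p) ^ 3, by positivity,
    fun t ht => P.integral_card_mixedTriangles_le hp0 hp1 ht⟩
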